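/- arXiv:1503.03785 — 3 statements merged into one kernel-verified Lean document; each statement's English description precedes it below -/
import Mathlib

section
/- Let A ∈ N be a redundancy-free abstract Swiss cheese with δ₁(A) > 0, set M = μ(A), R = ρ(A), let S̃ be the set of all B ∈ N(M,R) partially above A, let S₁ = {B ∈ S̃ : δ₁(B) = sup_{C ∈ S̃} δ₁(C)}, and let S₂ = {B ∈ S₁ : δ₂(B) = inf_{C ∈ S₁} δ₂(C)}. Then every abstract Swiss cheese in S₂ is classical. -/
open Metric Set Filter Topology ENNReal

noncomputable section

/-- Abstract Swiss cheese space `F = (ℂ × [0,∞))^{ℕ₀}` with the product topology. -/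
abbrev ASC := ℕ → ℂ × NNReal

/-- The centre of the `n`-th disk. -/
def ctr (A : ASC) (n : ℕ) : ℂ := (A n).1

/-- The radius of the `n`-th disk, as a real number. -/
def rad (A : ASC) (n : ℕ) : ℝ := ((A n).2 : ℝ)

/-- The associated Swiss cheese set `X_A`. -/
def Xset (A : ASC) : Set ℂ :=
  closedBall (ctr A 0) (rad A 0) \ ⋃ n : ℕ, ball (ctr A (n + 1)) (rad A (n + 1))

/-- The significant index set `S_A = {n ≥ 1 : r_n > 0}`. -/
def SIdx (A : ASC) : Set ℕ := {n | 1 ≤ n ∧ 0 < rad A n}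

/-- The radius sum function `ρ(A) = ∑_{n≥1} r_n`, valued in `[0,∞]`. -/
def rhoSum (A : ASC) : ℝ≥0∞ := ∑' n : ℕ, ((A (n + 1)).2 : ℝ≥0∞)

/-- The centre bound function `μ(A) = sup_{n≥1} |a_n|`, valued in `[0,∞]`. -/
def muSup (A : ASC) : ℝ≥0∞ := ⨆ n : ℕ, (‖(A (n + 1)).1‖₊ : ℝ≥0∞)

/-- `H_A(E) = {n ∈ S_A : B̄(a_n, r_n) ∩ E ≠ ∅}`. -/
def HIdx (A : ASC) (E : Set ℂ) : Set ℕ :=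
  {n | n ∈ SIdx A ∧ (closedBall (ctr A n) (rad A n) ∩ E).Nonempty}

/-- The local radius sum function `ρ_E(A) = ∑_{n ∈ H_A(E)} r_n`. -/
def rhoLoc (A : ASC) (E : Set ℂ) : ℝ≥0∞ :=
  ∑' n : HIdx A E, ((A (n : ℕ)).2 : ℝ≥0∞)

/-- The discrepancy function of order 1, `δ₁(A) = r_0 − ∑_{n≥1} r_n ∈ [−∞,∞)`. -/
def delta1 (A : ASC) : EReal := (rad A 0 : EReal) - ((rhoSum A : ℝ≥0∞) : EReal)

/-- The discrepancy function of order `α`, `δ_α(A) = r_0^α − ∑_{n≥1} r_n^α ∈ [−∞,∞)`. -/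
def deltaAlpha (α : ℝ) (A : ASC) : EReal :=
  ((((A 0).2 : ℝ≥0∞) ^ α : ℝ≥0∞) : EReal) -
    ((∑' n : ℕ, ((A (n + 1)).2 : ℝ≥0∞) ^ α : ℝ≥0∞) : EReal)

/-- The discrepancy function of order 2. -/
def delta2 (A : ASC) : EReal := deltaAlpha 2 A

/-- `A` is classical. -/
def IsClassicalASC (A : ASC) : Prop :=
  rhoSum A < ⊤ ∧ 0 < rad A 0 ∧
  ∀ k ∈ SIdx A,
    closedBall (ctr A k) (rad A k) ⊆ ball (ctr A 0) (rad A 0) ∧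
    ∀ l ∈ SIdx A, l ≠ k →
      closedBall (ctr A k) (rad A k) ∩ closedBall (ctr A l) (rad A l) = ∅

/-- `A` is semiclassical. -/
def IsSemiclassicalASC (A : ASC) : Prop :=
  rhoSum A < ⊤ ∧ 0 < rad A 0 ∧
  ∀ k ∈ SIdx A,
    ball (ctr A k) (rad A k) ⊆ ball (ctr A 0) (rad A 0) ∧
    ∀ l ∈ SIdx A, l ≠ k →
      ball (ctr A k) (rad A k) ∩ ball (ctr A l) (rad A l) = ∅

/-- Membership in `N`: finite radius sum and `(r_n)_{n≥1}` non-increasing. -/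
def memN (A : ASC) : Prop :=
  rhoSum A < ⊤ ∧ ∀ n : ℕ, 1 ≤ n → (A (n + 1)).2 ≤ (A n).2

/-- Membership in `N(M,R)`. -/
def memNMR (M R : ℝ≥0∞) (A : ASC) : Prop := memN A ∧ muSup A ≤ M ∧ rhoSum A ≤ R

/-- `A` is redundancy-free. -/
def RedundancyFree (A : ASC) : Prop :=
  ∀ k ∈ SIdx A,
    (ball (ctr A k) (rad A k) ∩ closedBall (ctr A 0) (rad A 0)).Nonempty ∧
    ∀ l ∈ SIdx A, l ≠ k → ¬ ball (ctr A k) (rad A k) ⊆ ball (ctr A l) (rad A l)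

/-- `B` is partially above `A`. -/
def PartiallyAbove (B A : ASC) : Prop :=
  closedBall (ctr B 0) (rad B 0) ⊆ closedBall (ctr A 0) (rad A 0) ∧
  ∀ n : ℕ, 1 ≤ n →
    ball (ctr A n) (rad A n) ⊆ (closedBall (ctr B 0) (rad B 0))ᶜ ∨
    ∃ m : ℕ, 1 ≤ m ∧ ball (ctr A n) (rad A n) ⊆ ball (ctr B m) (rad B m)

/-- The set `S̃` of all `B ∈ N(μ(A), ρ(A))` partially above `A`. -/
def Stilde (A : ASC) : Set ASC :=
  {B | memNMR (muSup A) (rhoSum A) B ∧ PartiallyAbove B A}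

/-- `S₁`: the elements of `S̃` on which `δ₁` attains its supremum over `S̃`. -/
def S1 (A : ASC) : Set ASC :=
  {B ∈ Stilde A | delta1 B = sSup (delta1 '' Stilde A)}

/-- `S₂`: the elements of `S₁` on which `δ₂` attains its infimum over `S₁`. -/
def S2 (A : ASC) : Set ASC :=
  {B ∈ S1 A | delta2 B = sInf (delta2 '' S1 A)}

/-- The (classical) error set `E(A)`. -/
def errSet (A : ASC) : Set ℂ :=
  (⋃ m ∈ SIdx A, ⋃ n ∈ SIdx A, ⋃ (_ : m ≠ n),
    closedBall (ctr A m) (rad A m) ∩ closedBall (ctr A n) (rad A n)) ∪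
  ⋃ n ∈ SIdx A, (ball (ctr A 0) (rad A 0))ᶜ ∩ closedBall (ctr A n) (rad A n)

/-- `V(C) = ⋃_{n∈I} U_n`. -/
def VC (I : Set ℕ) (U : ℕ → Set ℂ) : Set ℂ := ⋃ n ∈ I, U n

/-- `F(C) = ⋃_{n∈I} K_n`. -/
def FC (I : Set ℕ) (K : ℕ → Set ℂ) : Set ℂ := ⋃ n ∈ I, K n

/-- The set `L_A(C)` for a controlling collection `C = ((K_n, U_n))_{n∈I}`. -/
def LSet (A : ASC) (I : Set ℕ) (K U : ℕ → Set ℂ) : Set ASC :=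
  {B | memNMR (muSup A) (rhoSum A) B ∧
    (∀ n ∈ I, rhoLoc B (U n) ≤ rhoLoc A (U n)) ∧
    closedBall (ctr B 0) (rad B 0) = closedBall (ctr A 0) (rad A 0) ∧
    (∀ k ∈ SIdx A, closedBall (ctr A k) (rad A k) ∩ VC I U = ∅ →
      ∃ l ∈ SIdx B, ball (ctr B l) (rad B l) = ball (ctr A k) (rad A k)) ∧
    (∀ n ∈ I, ∀ k ∈ SIdx A, (closedBall (ctr A k) (rad A k) ∩ U n).Nonempty →
      (∃ l ∈ SIdx B, ball (ctr B l) (rad B l) = ball (ctr A k) (rad A k)) ∨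
      (∃ l ∈ HIdx B (K n), ball (ctr A k) (rad A k) ⊆ ball (ctr B l) (rad B l)))}

/-- `A` is annular: `a_0 = a_1` and `0 < r_1 < r_0`. -/
def Annular (A : ASC) : Prop := ctr A 0 = ctr A 1 ∧ 0 < rad A 1 ∧ rad A 1 < rad A 0

/-- The annular radius sum `ρ_a(A) = ∑_{n≥2} r_n`. -/
def rhoAnn (A : ASC) : ℝ≥0∞ := ∑' n : ℕ, ((A (n + 2)).2 : ℝ≥0∞)

/-- The annular discrepancy `δ_a(A) = r_0 − r_1 − 2ρ_a(A)`. -/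
def deltaAnn (A : ASC) : EReal :=
  ((rad A 0 - rad A 1 : ℝ) : EReal) - ((2 * rhoAnn A : ℝ≥0∞) : EReal)

/-- The family `Ã` of Lemma 6.4 / Theorem 6.6 (annular classicalisation). -/
def ATilde (A : ASC) : Set ASC :=
  {B | (∀ n : ℕ, 2 ≤ n → (B (n + 1)).2 ≤ (B n).2) ∧
    rhoAnn B ≤ rhoAnn A ∧ muSup B ≤ muSup A ∧ PartiallyAbove B A ∧
    ctr B 0 = ctr A 0 ∧ ctr B 1 = ctr A 0 ∧
    rad A 1 ≤ rad B 1 ∧ rad B 1 ≤ rad B 0 ∧ rad B 0 ≤ rad A 0}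


/-- The order embedding `ℕ → ℕ` whose range omits exactly `p`. -/
def natSkip (p n : ℕ) : ℕ := if n < p then n else n + 1

lemma natSkip_monotone (p : ℕ) : Monotone (natSkip p) := by
  intro m n h
  unfold natSkip
  split_ifs <;> omega

lemma exists_natSkip_eq {p n : ℕ} (h : n ≠ p) : ∃ m, natSkip p m = n := by
  rcases lt_or_gt_of_ne h with h | h
  · exact ⟨n, by simp [natSkip, h]⟩
  · refine ⟨n - 1, ?_⟩
    unfold natSkip
    split_ifs <;> omega

lemma tsum_eq_add_tsum_natSkip (p : ℕ) (h : ℕ → ℝ≥0∞) :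
    ∑' n, h n = h p + ∑' n, h (natSkip p n) := by
  induction p generalizing h with
  | zero => simpa [natSkip] using tsum_eq_zero_add' (f := h) ENNReal.summable
  | succ p ih =>
    rw [tsum_eq_zero_add' (f := h) ENNReal.summable, ih fun n => h (n + 1),
      tsum_eq_zero_add' (f := fun n => h (natSkip (p + 1) n)) ENNReal.summable]
    have h₁ : ∀ n, natSkip (p + 1) (n + 1) = natSkip p n + 1 := by
      intro n
      unfold natSkip
      split_ifs <;> omega
    have h₂ : natSkip (p + 1) 0 = 0 := by simp [natSkip]
    simp only [h₁, h₂]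
    ring

/-- Insert the value `x` into the sequence `f` at position `p`. -/
def insertSeq {α : Type*} (f : ℕ → α) (p : ℕ) (x : α) (n : ℕ) : α :=
  if n < p then f n else if n = p then x else f (n - 1)

lemma insertSeq_self {α : Type*} (f : ℕ → α) (p : ℕ) (x : α) : insertSeq f p x p = x := by
  simp [insertSeq]

lemma insertSeq_natSkip {α : Type*} (f : ℕ → α) (p : ℕ) (x : α) (n : ℕ) :
    insertSeq f p x (natSkip p n) = f n := by
  unfold insertSeq natSkip
  split_ifs <;> first | rfl | omega

lemma tsum_insertSeq {α : Type*} (f : ℕ → α) (p : ℕ) (x : α) (φ : α → ℝ≥0∞) :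
    ∑' n, φ (insertSeq f p x n) = φ x + ∑' n, φ (f n) := by
  rw [tsum_eq_add_tsum_natSkip p]
  simp only [insertSeq_self, insertSeq_natSkip]

/-- A disk of positive radius can be inserted into a sequence of disks with non-increasing
summable radii so that the radii stay non-increasing. -/
lemma exists_antitone_insertSeq (f : ℕ → ℂ × NNReal) (hf : Antitone fun n => (f n).2)
    (hs : ∑' n, ((f n).2 : ℝ≥0∞) ≠ ⊤) (x : ℂ × NNReal) (hx : 0 < x.2) :
    ∃ p, Antitone fun n => (insertSeq f p x n).2 := by
  classical
  have hlim : Tendsto (fun n => (f n).2) atTop (𝓝 0) :=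
    NNReal.tendsto_atTop_zero_of_summable (ENNReal.tsum_coe_ne_top_iff_summable.1 hs)
  have hex : ∃ n, (f n).2 < x.2 := (hlim.eventually_lt_const hx).exists
  refine ⟨Nat.find hex, antitone_nat_of_succ_le fun n => ?_⟩
  have hlt := Nat.find_spec hex
  have hge : ∀ m, m < Nat.find hex → x.2 ≤ (f m).2 := fun m hm => not_lt.1 (Nat.find_min hex hm)
  generalize Nat.find hex = p at hlt hge
  unfold insertSeq
  rcases lt_trichotomy (n + 1) p with h | h | h
  · simpa [h, (by omega : n < p)] using hf (Nat.le_succ n)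
  · simpa [h, (by omega : n < p)] using hge n (by omega)
  · rcases eq_or_ne n p with rfl | h'
    · simpa using hlt.le
    · rw [if_neg (by omega), if_neg (by omega), if_neg (by omega), if_neg h']
      exact hf (Nat.sub_le n 1)

/-- The abstract Swiss cheese with outer disk `c` and removed disks `g`. -/
def consASC (c : ℂ × NNReal) (g : ℕ → ℂ × NNReal) : ASC
  | 0 => c
  | n + 1 => g n

lemma deltaAlpha_two (B : ASC) : delta2 B =
    (((B 0).2 ^ 2 : ℝ≥0∞) : EReal) - ((∑' n, ((B (n + 1)).2 : ℝ≥0∞) ^ 2 : ℝ≥0∞) : EReal) := by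
  simp [delta2, deltaAlpha]

lemma tsum_sq_ne_top {f : ℕ → ℝ≥0∞} (hf : ∑' n, f n ≠ ⊤) : ∑' n, f n ^ 2 ≠ ⊤ := by
  refine ne_top_of_le_ne_top (ENNReal.mul_ne_top hf hf) ?_
  rw [← ENNReal.tsum_mul_left]
  refine ENNReal.tsum_le_tsum fun n => ?_
  rw [sq]
  gcongr
  exact ENNReal.le_tsum n

lemma delta1_eq (B : ASC) {T : NNReal} (hT : rhoSum B = T) :
    delta1 B = (((B 0).2 - T : ℝ) : EReal) := by
  rw [delta1, hT, EReal.coe_sub]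
  rfl

lemma delta2_eq (B : ASC) {T : NNReal} (hT : ∑' n, ((B (n + 1)).2 : ℝ≥0∞) ^ 2 = T) :
    delta2 B = ((((B 0).2 : ℝ) ^ 2 - T : ℝ) : EReal) := by
  rw [deltaAlpha_two, hT, EReal.coe_sub, ← ENNReal.coe_pow]
  rfl

lemma self_mem_Stilde {A : ASC} (hN : memN A) : A ∈ Stilde A :=
  ⟨⟨hN, le_rfl, le_rfl⟩, Subset.rfl, fun n hn => Or.inr ⟨n, hn, Subset.rfl⟩⟩

lemma delta2_le_of_mem_S2 {A B C : ASC} (hB : B ∈ S2 A) (hC : C ∈ Stilde A)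
    (h : delta1 C = delta1 B) : delta2 B ≤ delta2 C :=
  hB.2.trans_le (sInf_le ⟨C, ⟨hC, h.trans hB.1.2⟩, rfl⟩)

lemma consASC_mem_Stilde {A : ASC} {c : ℂ × NNReal} {g : ℕ → ℂ × NNReal}
    (hanti : Antitone fun n => (g n).2) (hs : ∑' n, ((g n).2 : ℝ≥0∞) ≤ rhoSum A)
    (hA : rhoSum A < ⊤) (hM : ∀ n, (‖(g n).1‖₊ : ℝ≥0∞) ≤ muSup A)
    (hP : PartiallyAbove (consASC c g) A) : consASC c g ∈ Stilde A := by
  refine ⟨⟨⟨lt_of_le_of_lt hs hA, fun n hn => ?_⟩, iSup_le hM, hs⟩, hP⟩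
  obtain ⟨m, rfl⟩ := Nat.exists_eq_add_of_le' hn
  exact hanti (Nat.le_succ m)

/-- Two closed disks which meet have their open disks contained in a disk whose radius is the sum of
their radii and whose centre is a convex combination of their centres. -/
lemma exists_ball_superset {a b : ℂ} {r s M : ℝ} (hr : 0 < r) (hs : 0 < s)
    (h : dist a b ≤ r + s) (ha : ‖a‖ ≤ M) (hb : ‖b‖ ≤ M) :
    ∃ c : ℂ, ‖c‖ ≤ M ∧ ball a r ⊆ ball c (r + s) ∧ ball b s ⊆ ball c (r + s) := by
  have hrs : 0 < r + s := by positivity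
  have hsum : r / (r + s) + s / (r + s) = 1 := by field_simp
  have hra : 0 ≤ r / (r + s) := by positivity
  have hsb : 0 ≤ s / (r + s) := by positivity
  refine ⟨AffineMap.lineMap a b (s / (r + s)), ?_, ball_subset_ball' ?_, ball_subset_ball' ?_⟩
  · have := (convex_closedBall (0 : ℂ) M) (x := a) (by simpa using ha) (y := b) (by simpa using hb)
      hra hsb hsum
    rw [AffineMap.lineMap_apply_module, ← eq_sub_of_add_eq hsum]
    simpa using this
  · have : s / (r + s) * dist a b ≤ s := by
      rw [div_mul_eq_mul_div, div_le_iff₀ hrs]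
      exact mul_le_mul_of_nonneg_left h hs.le
    rw [dist_left_lineMap, Real.norm_of_nonneg hsb]
    linarith
  · have : r / (r + s) * dist a b ≤ r := by
      rw [div_mul_eq_mul_div, div_le_iff₀ hrs]
      exact mul_le_mul_of_nonneg_left h hr.le
    rw [dist_comm, dist_lineMap_right, ← eq_sub_of_add_eq hsum, Real.norm_of_nonneg hra]
    linarith

/-- A closed disk of radius `s` contains a closed disk of radius `s - t` avoiding a given open disk
of radius `t < s` which is not compactly contained in it. -/
lemma exists_closedBall_subset {a b : ℂ} {s t : ℝ} (ht : 0 ≤ t) (hts : t < s)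
    (h : s ≤ dist b a + t) :
    ∃ c : ℂ, closedBall c (s - t) ⊆ closedBall a s ∧ ball b t ⊆ (closedBall c (s - t))ᶜ := by
  have hd : 0 < dist b a := by linarith
  have hnorm : ‖a - b‖ = dist b a := by rw [dist_comm, dist_eq_norm]
  refine ⟨a + (t / dist b a : ℝ) • (a - b), closedBall_subset_closedBall' ?_, ?_⟩
  · rw [dist_eq_norm, add_sub_cancel_left, norm_smul, hnorm, Real.norm_of_nonneg (by positivity),
      div_mul_cancel₀ _ hd.ne']
    linarith
  · have hdist : dist b (a + (t / dist b a : ℝ) • (a - b)) = dist b a + t := by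
      have : a + (t / dist b a : ℝ) • (a - b) - b = (1 + t / dist b a : ℝ) • (a - b) := by
        rw [add_smul, one_smul]
        ring
      rw [dist_comm, dist_eq_norm, this, norm_smul, hnorm, Real.norm_of_nonneg (by positivity)]
      field_simp
    refine subset_compl_iff_disjoint_right.2 (ball_disjoint_closedBall ?_)
    rw [hdist]
    linarith

lemma antitone_of_memN {B : ASC} (hB : memN B) : Antitone fun n => (B (n + 1)).2 :=
  antitone_nat_of_succ_le fun n => hB.2 (n + 1) (by omega)

/-- In an element of `S₂` with positive discrepancy, each removed closed disk lies in the interior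
of the outer disk. -/
lemma closedBall_subset_of_mem_S2 {A B : ASC} (hN : memN A) (hB : B ∈ S2 A) (hd : 0 < delta1 B)
    {k : ℕ} (hk : 0 < rad B (k + 1)) :
    closedBall (ctr B (k + 1)) (rad B (k + 1)) ⊆ ball (ctr B 0) (rad B 0) := by
  by_contra hnot
  obtain ⟨⟨⟨⟨hBN, hBM, hBR⟩, hBP₀, hBP⟩, -⟩, -⟩ := id hB
  set g : ℕ → ℂ × NNReal := fun n => B (natSkip k n + 1)
  have hsum : rhoSum B = (B (k + 1)).2 + ∑' n, ((g n).2 : ℝ≥0∞) :=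
    tsum_eq_add_tsum_natSkip k _
  have hsum2 : ∑' n, ((B (n + 1)).2 : ℝ≥0∞) ^ 2 =
      ((B (k + 1)).2 : ℝ≥0∞) ^ 2 + ∑' n, ((g n).2 : ℝ≥0∞) ^ 2 :=
    tsum_eq_add_tsum_natSkip k _
  have hgle : ∑' n, ((g n).2 : ℝ≥0∞) ≤ rhoSum B := hsum ▸ le_add_self
  have hfin : ∑' n, ((g n).2 : ℝ≥0∞) ≠ ⊤ := ne_top_of_le_ne_top hBN.1.ne hgle
  obtain ⟨T, hT⟩ : ∃ T : NNReal, (T : ℝ≥0∞) = ∑' n, ((g n).2 : ℝ≥0∞) :=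
    ⟨_, ENNReal.coe_toNNReal hfin⟩
  obtain ⟨T₂, hT₂⟩ : ∃ T : NNReal, (T : ℝ≥0∞) = ∑' n, ((g n).2 : ℝ≥0∞) ^ 2 :=
    ⟨_, ENNReal.coe_toNNReal (tsum_sq_ne_top hfin)⟩
  have hB₁ := delta1_eq B (T := (B (k + 1)).2 + T) (by rw [hsum, ← hT, ENNReal.coe_add])
  have hB₂ := delta2_eq B (T := (B (k + 1)).2 ^ 2 + T₂)
    (by rw [hsum2, ← hT₂, ENNReal.coe_add, ENNReal.coe_pow])
  have hlt : rad B (k + 1) < rad B 0 := by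
    rw [hB₁] at hd
    have : (0 : ℝ) < (B 0).2 - ((B (k + 1)).2 + T : NNReal) := by exact_mod_cast hd
    push_cast at this
    have := T.coe_nonneg
    unfold rad
    linarith
  have hdist : rad B 0 ≤ dist (ctr B (k + 1)) (ctr B 0) + rad B (k + 1) := by
    by_contra! h
    exact hnot (closedBall_subset_ball' (by linarith))
  obtain ⟨c, hc₁, hc₂⟩ := exists_closedBall_subset hk.le hlt hdist
  have hrad : (((B 0).2 - (B (k + 1)).2 : NNReal) : ℝ) = rad B 0 - rad B (k + 1) :=
    NNReal.coe_sub (NNReal.coe_le_coe.1 hlt.le)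
  set C : ASC := consASC (c, (B 0).2 - (B (k + 1)).2) g
  have hC : C ∈ Stilde A := by
    refine consASC_mem_Stilde
      (fun m n h => antitone_of_memN hBN (natSkip_monotone k h)) (hgle.trans hBR) hN.1
      (fun n => (le_iSup (fun n => (‖(B (n + 1)).1‖₊ : ℝ≥0∞)) _).trans hBM) ?_
    change closedBall c (((B 0).2 - (B (k + 1)).2 : NNReal) : ℝ) ⊆ _ ∧ ∀ n : ℕ, 1 ≤ n →
      _ ⊆ (closedBall c (((B 0).2 - (B (k + 1)).2 : NNReal) : ℝ))ᶜ ∨ _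
    rw [hrad]
    refine ⟨hc₁.trans hBP₀, fun n hn => ?_⟩
    rcases hBP n hn with h | ⟨m, hm, h⟩
    · exact Or.inl (h.trans (compl_subset_compl.2 hc₁))
    obtain ⟨m, rfl⟩ := Nat.exists_eq_add_of_le' hm
    rcases eq_or_ne m k with rfl | hmk
    · exact Or.inl (h.trans hc₂)
    · obtain ⟨j, rfl⟩ := exists_natSkip_eq hmk
      exact Or.inr ⟨j + 1, by omega, h⟩
  have hC₁ := delta1_eq C (T := T) hT.symm
  have hC₂ := delta2_eq C (T := T₂) hT₂.symm
  have hC₀ : ((C 0).2 : ℝ) = (B 0).2 - (B (k + 1)).2 := hrad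
  have hle := delta2_le_of_mem_S2 hB hC (by rw [hC₁, hB₁, hC₀, NNReal.coe_add, sub_sub])
  rw [hB₂, hC₂, EReal.coe_le_coe_iff, hC₀] at hle
  push_cast at hle
  unfold rad at hk hlt
  nlinarith

/-- In an element of `S₂`, the removed closed disks are pairwise disjoint. -/
lemma closedBall_inter_eq_empty_of_mem_S2 {A B : ASC} (hN : memN A) (hB : B ∈ S2 A) {k l : ℕ}
    (hk : 0 < rad B (k + 1)) (hl : 0 < rad B (l + 1)) (hlk : l ≠ k) :
    closedBall (ctr B (k + 1)) (rad B (k + 1)) ∩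
      closedBall (ctr B (l + 1)) (rad B (l + 1)) = ∅ := by
  by_contra hne
  obtain ⟨⟨⟨⟨hBN, hBM, hBR⟩, hBP₀, hBP⟩, -⟩, -⟩ := id hB
  obtain ⟨j, rfl⟩ := exists_natSkip_eq hlk
  set l := natSkip k j
  set g : ℕ → ℂ × NNReal := fun n => B (natSkip k (natSkip j n) + 1)
  have hsplit (φ : ℂ × NNReal → ℝ≥0∞) :
      ∑' n, φ (B (n + 1)) = φ (B (k + 1)) + (φ (B (l + 1)) + ∑' n, φ (g n)) := by
    rw [tsum_eq_add_tsum_natSkip k, tsum_eq_add_tsum_natSkip j]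
  have hsum : rhoSum B = _ := hsplit fun x => x.2
  have hsum2 := hsplit fun x => (x.2 : ℝ≥0∞) ^ 2
  have hfin : ∑' n, ((g n).2 : ℝ≥0∞) ≠ ⊤ :=
    ne_top_of_le_ne_top hBN.1.ne (hsum ▸ le_add_self.trans le_add_self)
  have hcM (n : ℕ) : (‖(B (n + 1)).1‖₊ : ℝ≥0∞) ≤ muSup A :=
    (le_iSup (fun n => (‖(B (n + 1)).1‖₊ : ℝ≥0∞)) n).trans hBM
  obtain ⟨c, hcle, hck, hcl⟩ := exists_ball_superset hk hl
    (dist_le_add_of_nonempty_closedBall_inter_closedBall (nonempty_iff_ne_empty.2 hne))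
    (le_max_left ‖ctr B (k + 1)‖ ‖ctr B (l + 1)‖) (le_max_right _ _)
  have hcA : (‖c‖₊ : ℝ≥0∞) ≤ muSup A := by
    rcases le_max_iff.1 hcle with h | h
    · exact le_trans (by exact_mod_cast h) (hcM k)
    · exact le_trans (by exact_mod_cast h) (hcM l)
  set x : ℂ × NNReal := (c, (B (k + 1)).2 + (B (l + 1)).2)
  obtain ⟨p, hp⟩ := exists_antitone_insertSeq g
    (fun m n h => antitone_of_memN hBN (natSkip_monotone k (natSkip_monotone j h))) hfin x
    (add_pos (NNReal.coe_pos.1 hk) (NNReal.coe_pos.1 hl))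
  set C : ASC := consASC (B 0) (insertSeq g p x)
  have hrho : rhoSum C = rhoSum B := by
    rw [hsum, ← add_assoc]
    exact tsum_insertSeq g p x fun x => x.2
  have hCsq : ∑' n, ((C (n + 1)).2 : ℝ≥0∞) ^ 2 = _ :=
    tsum_insertSeq g p x fun x => (x.2 : ℝ≥0∞) ^ 2
  have hself : C (p + 1) = x := insertSeq_self g p x
  have hskip (n : ℕ) : C (natSkip p n + 1) = g n := insertSeq_natSkip g p x n
  have hC : C ∈ Stilde A := by
    refine consASC_mem_Stilde hp (hrho.trans_le hBR) hN.1 (fun n => ?_) ⟨hBP₀, fun n hn => ?_⟩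
    · change (‖(C (n + 1)).1‖₊ : ℝ≥0∞) ≤ _
      rcases eq_or_ne n p with rfl | hnp
      · rwa [hself]
      · obtain ⟨i, rfl⟩ := exists_natSkip_eq hnp
        rw [hskip]
        exact hcM _
    rcases hBP n hn with h | ⟨m, hm, h⟩
    · exact Or.inl h
    refine Or.inr ?_
    change ∃ m, 1 ≤ m ∧ ball (ctr A n) (rad A n) ⊆ ball (C m).1 (C m).2
    obtain ⟨m, rfl⟩ := Nat.exists_eq_add_of_le' hm
    rcases eq_or_ne m k with rfl | hmk
    · exact ⟨p + 1, by omega, by rw [hself]; exact h.trans hck⟩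
    obtain ⟨i, rfl⟩ := exists_natSkip_eq hmk
    rcases eq_or_ne i j with rfl | hij
    · exact ⟨p + 1, by omega, by rw [hself]; exact h.trans hcl⟩
    obtain ⟨q, rfl⟩ := exists_natSkip_eq hij
    exact ⟨natSkip p q + 1, by omega, by rw [hskip]; exact h⟩
  have hle := delta2_le_of_mem_S2 hB hC (by rw [delta1, delta1, hrho]; rfl)
  obtain ⟨T, hT⟩ : ∃ T : NNReal, (T : ℝ≥0∞) = ∑' n, ((g n).2 : ℝ≥0∞) ^ 2 :=
    ⟨_, ENNReal.coe_toNNReal (tsum_sq_ne_top hfin)⟩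
  rw [delta2_eq B (T := (B (k + 1)).2 ^ 2 + ((B (l + 1)).2 ^ 2 + T))
      (by rw [hsum2, ← hT]; push_cast; rfl),
    delta2_eq C (T := ((B (k + 1)).2 + (B (l + 1)).2) ^ 2 + T)
      (by rw [hCsq, ← hT]; push_cast; rfl), EReal.coe_le_coe_iff] at hle
  have hC₀ : (C 0).2 = (B 0).2 := rfl
  rw [hC₀] at hle
  push_cast at hle
  unfold rad at hk hl
  nlinarith [mul_pos hk hl]

/-- Theorem 4.9: all abstract Swiss cheeses in `S₂` are classical. -/
theorem stmt10 (A : ASC) (hN : memN A) (hrf : RedundancyFree A) (hd : 0 < delta1 A) :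
    ∀ B ∈ S2 A, IsClassicalASC B := by
  intro B hB
  have hdB : 0 < delta1 B :=
    hd.trans_le ((le_sSup (mem_image_of_mem delta1 (self_mem_Stilde hN))).trans_eq
      hB.1.2.symm)
  have hfin : rhoSum B < ⊤ := hB.1.1.1.1.1
  refine ⟨hfin, ?_, fun k hk => ?_⟩
  · rw [delta1_eq B (ENNReal.coe_toNNReal hfin.ne).symm] at hdB
    have : (0 : ℝ) < (B 0).2 - (rhoSum B).toNNReal := by exact_mod_cast hdB
    exact (NNReal.coe_nonneg _).trans_lt (sub_pos.1 this)
  obtain ⟨hk₁, hk₀⟩ := hk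
  obtain ⟨k, rfl⟩ := Nat.exists_eq_add_of_le' hk₁
  refine ⟨closedBall_subset_of_mem_S2 hN hB hdB hk₀, fun l hl hlk => ?_⟩
  obtain ⟨hl₁, hl₀⟩ := hl
  obtain ⟨l, rfl⟩ := Nat.exists_eq_add_of_le' hl₁
  exact closedBall_inter_eq_empty_of_mem_S2 hN hB hk₀ hl₀ (by omega)

end
end

section
/- Let A = ((a_n, r_n)) be an annular abstract Swiss cheese with δ_a(A) > 0, μ(A) < ∞ and (r_n)_{n≥2} non-increasing, and let Ã be the family of all B = ((b_n, s_n)) ∈ F such that: (a) (s_n)_{n≥2} is non-increasing; (b) ρ_a(B) ≤ ρ_a(A); (c) μ(B) ≤ μ(A); (d) B is partially above A; and (e) b_0 = b_1 = a_0 and r_0 ≥ s_0 ≥ s_1 ≥ r_1. Then there exists a classical annular abstract Swiss cheese B = ((b_n, s_n)) ∈ Ã such that δ_a(B) ≥ δ_a(A) and X_B ⊆ X_A; moreover r_0 − 2ρ_a(A) ≤ s_0 ≤ r_0 and r_1 ≤ s_1 ≤ r_1 + 2ρ_a(A). (Annular classicalisation theorem.) -/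
open Metric Set Filter Topology ENNReal

noncomputable section

/-- The increasing enumeration of `ℕ \ {k}`. -/
def skip (k n : ℕ) : ℕ := if n < k then n else n + 1

lemma skip_of_lt {k n : ℕ} (h : n < k) : skip k n = n := if_pos h

lemma skip_of_le {k n : ℕ} (h : k ≤ n) : skip k n = n + 1 := if_neg h.not_gt

lemma skip_mono (k : ℕ) : Monotone (skip k) := by
  intro a b h
  unfold skip
  split_ifs <;> omega

lemma exists_skip_eq {k i : ℕ} (h : i ≠ k) : ∃ j, skip k j = i := by
  rcases lt_or_gt_of_ne h with h | h
  · exact ⟨i, skip_of_lt h⟩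
  · exact ⟨i - 1, by rw [skip_of_le (by omega)]; omega⟩

lemma tsum_eq_add_tsum_skip (g : ℕ → ℝ≥0∞) (k : ℕ) :
    ∑' n, g n = g k + ∑' n, g (skip k n) := by
  induction k generalizing g with
  | zero => simpa [skip] using tsum_eq_zero_add' (f := g) ENNReal.summable
  | succ k ih =>
    rw [tsum_eq_zero_add' (f := g) ENNReal.summable, ih,
      tsum_eq_zero_add' (f := fun n => g (skip (k + 1) n)) ENNReal.summable]
    have h (n : ℕ) : skip (k + 1) (n + 1) = skip k n + 1 := by
      unfold skip
      split_ifs <;> omega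
    simp only [h, skip_of_lt k.succ_pos]
    ring

/-- A disk of positive radius can be inserted into a sequence of disks with non-increasing,
summable radii so that the radii remain non-increasing. -/
lemma exists_insert_antitone {T : ℕ → ℂ × NNReal} (hT : Antitone fun n => (T n).2)
    (hsum : ∑' n, ((T n).2 : ℝ≥0∞) ≠ ⊤) {x : ℂ × NNReal} (hx : 0 < x.2) :
    ∃ (k : ℕ) (T' : ℕ → ℂ × NNReal), T' k = x ∧ (∀ n, T' (skip k n) = T n) ∧
      Antitone fun n => (T' n).2 := by
  classical
  have hex : ∃ n, (T n).2 ≤ x.2 := by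
    have h := (ENNReal.tendsto_atTop_zero_of_tsum_ne_top hsum).eventually_le_const
      (ENNReal.coe_pos.2 hx)
    obtain ⟨n, hn⟩ := h.exists
    exact ⟨n, by exact_mod_cast hn⟩
  set k := Nat.find hex with hk
  have hk1 : (T k).2 ≤ x.2 := Nat.find_spec hex
  have hk2 (n : ℕ) (hn : n < k) : x.2 ≤ (T n).2 := (not_le.1 (Nat.find_min hex hn)).le
  refine ⟨k, fun n => if n < k then T n else if n = k then x else T (n - 1), by simp, ?_, ?_⟩
  · intro n
    rcases lt_or_ge n k with h | h
    · simp [skip_of_lt h, h]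
    · have h1 : ¬ n + 1 < k := by omega
      have h2 : n + 1 ≠ k := by omega
      simp [skip_of_le h, h1, h2]
  · refine antitone_nat_of_succ_le fun n => ?_
    rcases lt_trichotomy n k with h | rfl | h
    · rcases (Nat.succ_le_of_lt h).lt_or_eq with h' | h'
      · simpa [h, show n + 1 < k from h'] using hT n.le_succ
      · simpa [h, show n + 1 = k from h'] using hk2 n h
    · simpa using hk1
    · have h1 : ¬ n + 1 < k := by omega
      have h2 : n + 1 ≠ k := by omega
      have h3 : ¬ n < k := by omega
      have h4 : n ≠ k := by omega
      simpa [h1, h2, h3, h4] using hT (Nat.sub_le n 1)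

/-- If the radii are non-increasing then the `n`-th one is at most the radius sum
divided by `n + 1`. -/
lemma succ_mul_le_tsum {T : ℕ → ℂ × NNReal} (hT : Antitone fun n => (T n).2) (n : ℕ) :
    ((n + 1 : ℕ) : ℝ≥0∞) * (T n).2 ≤ ∑' i, ((T i).2 : ℝ≥0∞) := by
  refine le_trans ?_ (ENNReal.sum_le_tsum (Finset.range (n + 1)))
  have h : ∀ i ∈ Finset.range (n + 1), ((T n).2 : ℝ≥0∞) ≤ (T i).2 := fun i hi => by
    exact_mod_cast hT (Nat.lt_succ_iff.1 (Finset.mem_range.1 hi))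
  simpa using Finset.card_nsmul_le_sum _ _ _ h

/-- The disk `x` lies outside the disk of radius `s₀` about `c`, or inside the disk of radius
`s₁` about `c`, or inside a disk of `T`. -/
def Covers (c : ℂ) (s₀ s₁ : NNReal) (T : ℕ → ℂ × NNReal) (x : ℂ × NNReal) : Prop :=
  (x.2 + s₀ : ℝ) ≤ dist x.1 c ∨ (dist x.1 c + x.2 : ℝ) ≤ s₁ ∨
    ∃ m, (dist x.1 (T m).1 + x.2 : ℝ) ≤ (T m).2

/-- The annular cheeses centred at `c` with outer radius `s₀`, inner radius `s₁` and other disks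
`T` which compete with the one given by `r₀`, `r₁` and `D`. -/
structure Admissible (c : ℂ) (M r₀ r₁ : NNReal) (D : ℕ → ℂ × NNReal)
    (s₀ s₁ : NNReal) (T : ℕ → ℂ × NNReal) : Prop where
  anti : Antitone fun n => (T n).2
  norm_le : ∀ n, ‖(T n).1‖ ≤ M
  outer_le : s₀ ≤ r₀
  le_inner : r₁ ≤ s₁
  sum_le : (s₁ : ℝ≥0∞) + 2 * ∑' n, ((T n).2 : ℝ≥0∞) + r₀ ≤
    s₀ + (r₁ + 2 * ∑' n, ((D n).2 : ℝ≥0∞))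
  covers : ∀ n, 0 < (D n).2 → Covers c s₀ s₁ T (D n)

/-- A bounded, strictly subadditive weight on the radii. -/
def weight (t : NNReal) : NNReal := t / (1 + t)

lemma continuous_weight : Continuous weight := by
  unfold weight
  refine continuous_id.div (by fun_prop) fun t => ?_
  positivity

lemma weight_le (t : NNReal) : weight t ≤ t :=
  div_le_self zero_le (by simp)

lemma weight_pos {t : NNReal} (h : 0 < t) : 0 < weight t := by
  unfold weight
  positivity

lemma weight_add_lt {s t : NNReal} (hs : 0 < s) (ht : 0 < t) :
    weight (s + t) < weight s + weight t := by
  unfold weight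
  rw [add_div]
  gcongr <;> simpa

/-- The total weight of a sequence of disks. -/
def totalWeight (T : ℕ → ℂ × NNReal) : ℝ≥0∞ := ∑' n, (weight (T n).2 : ℝ≥0∞)

lemma totalWeight_le (T : ℕ → ℂ × NNReal) : totalWeight T ≤ ∑' n, ((T n).2 : ℝ≥0∞) :=
  ENNReal.tsum_le_tsum fun n => by exact_mod_cast weight_le _

lemma totalWeight_eq_add_skip (T : ℕ → ℂ × NNReal) (k : ℕ) :
    totalWeight T = weight (T k).2 + totalWeight fun n => T (skip k n) :=
  tsum_eq_add_tsum_skip _ k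

lemma lowerSemicontinuous_totalWeight : LowerSemicontinuous totalWeight := by
  refine lowerSemicontinuous_tsum fun n => Continuous.lowerSemicontinuous ?_
  exact ENNReal.continuous_coe.comp
    (continuous_weight.comp (continuous_snd.comp (continuous_apply n)))

namespace Admissible

variable {c : ℂ} {M r₀ r₁ s₀ s₁ : NNReal} {D T : ℕ → ℂ × NNReal}

lemma tsum_le (h : Admissible c M r₀ r₁ D s₀ s₁ T) :
    ∑' n, ((T n).2 : ℝ≥0∞) ≤ ∑' n, ((D n).2 : ℝ≥0∞) := by
  have h0 : (s₀ : ℝ≥0∞) ≤ r₀ := by exact_mod_cast h.outer_le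
  have h1 : (r₁ : ℝ≥0∞) ≤ s₁ := by exact_mod_cast h.le_inner
  have h2 : ((s₁ : ℝ≥0∞) + r₀) + 2 * ∑' n, ((T n).2 : ℝ≥0∞) ≤
      (s₁ + r₀) + 2 * ∑' n, ((D n).2 : ℝ≥0∞) := by
    calc _ = (s₁ : ℝ≥0∞) + 2 * ∑' n, ((T n).2 : ℝ≥0∞) + r₀ := by ring
      _ ≤ s₀ + (r₁ + 2 * ∑' n, ((D n).2 : ℝ≥0∞)) := h.sum_le
      _ ≤ r₀ + (s₁ + 2 * ∑' n, ((D n).2 : ℝ≥0∞)) := by gcongr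
      _ = _ := by ring
  rw [ENNReal.add_le_add_iff_left (by simp)] at h2
  rwa [ENNReal.mul_le_mul_iff_right (by simp) (by simp)] at h2

/-- The annular discrepancy inequality as an inequality of real numbers. -/
lemma toReal_sum_le (h : Admissible c M r₀ r₁ D s₀ s₁ T)
    (hD : ∑' n, ((D n).2 : ℝ≥0∞) ≠ ⊤) :
    (s₁ : ℝ) + 2 * (∑' n, ((T n).2 : ℝ≥0∞)).toReal + r₀ ≤
      s₀ + (r₁ + 2 * (∑' n, ((D n).2 : ℝ≥0∞)).toReal) := by
  have hT : ∑' n, ((T n).2 : ℝ≥0∞) ≠ ⊤ := ne_top_of_le_ne_top hD h.tsum_le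
  have h1 := h.sum_le
  lift ∑' n, ((T n).2 : ℝ≥0∞) to NNReal using hT with t
  lift ∑' n, ((D n).2 : ℝ≥0∞) to NNReal using hD with d
  exact_mod_cast h1

lemma refl (hD : Antitone fun n => (D n).2) (hM : ∀ n, ‖(D n).1‖ ≤ M) :
    Admissible c M r₀ r₁ D r₀ r₁ D where
  anti := hD
  norm_le := hM
  outer_le := le_rfl
  le_inner := le_rfl
  sum_le := by rw [add_comm]
  covers n _ := .inr (.inr ⟨n, by simp⟩)

/-- Removing a disk and absorbing it into the outside or into the inner disk. -/
lemma absorb (h : Admissible c M r₀ r₁ D s₀ s₁ T) (k : ℕ) {s₀' s₁' : NNReal}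
    (h₀ : s₀' ≤ s₀) (h₁ : s₁ ≤ s₁') (hs : s₁' + s₀ ≤ s₁ + s₀' + 2 * (T k).2)
    (hk : ∀ x : ℂ × NNReal, (dist x.1 (T k).1 + x.2 : ℝ) ≤ (T k).2 →
      (x.2 + s₀' : ℝ) ≤ dist x.1 c ∨ (dist x.1 c + x.2 : ℝ) ≤ s₁') :
    Admissible c M r₀ r₁ D s₀' s₁' fun n => T (skip k n) where
  anti := h.anti.comp_monotone (skip_mono k)
  norm_le n := h.norm_le _
  outer_le := h₀.trans h.outer_le
  le_inner := h.le_inner.trans h₁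
  sum_le := by
    have h1 := h.sum_le
    rw [tsum_eq_add_tsum_skip (fun n => ((T n).2 : ℝ≥0∞)) k] at h1
    have hs' : (s₁' : ℝ≥0∞) + s₀ ≤ s₁ + s₀' + 2 * (T k).2 := by exact_mod_cast hs
    set S := ∑' n, ((T (skip k n)).2 : ℝ≥0∞)
    set d := ∑' n, ((D n).2 : ℝ≥0∞)
    refine (ENNReal.add_le_add_iff_left (a := (s₁ : ℝ≥0∞) + s₀ + 2 * (T k).2)
      (by finiteness)).1 ?_
    calc (s₁ : ℝ≥0∞) + s₀ + 2 * (T k).2 + (s₁' + 2 * S + r₀)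
        = (s₁' + s₀) + (s₁ + 2 * ((T k).2 + S) + r₀) := by ring
      _ ≤ (s₁ + s₀' + 2 * (T k).2) + (s₀ + (r₁ + 2 * d)) := by gcongr
      _ = _ := by ring
  covers n hn := by
    rcases h.covers n hn with h' | h' | ⟨m, hm⟩
    · exact .inl (le_trans (by gcongr) h')
    · exact .inr (.inl (h'.trans (by exact_mod_cast h₁)))
    · rcases eq_or_ne m k with rfl | hmk
      · exact (hk _ hm).imp_right .inl
      · obtain ⟨j, rfl⟩ := exists_skip_eq hmk
        exact .inr (.inr ⟨j, hm⟩)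

/-- Replacing two touching disks by a disk containing both of them. -/
lemma exists_merge (h : Admissible c M r₀ r₁ D s₀ s₁ T)
    (hD : ∑' n, ((D n).2 : ℝ≥0∞) ≠ ⊤) {m n : ℕ} (hmn : m < n) (hm : 0 < (T m).2)
    (hn : 0 < (T n).2) (hd : dist (T m).1 (T n).1 ≤ (T m).2 + (T n).2) :
    ∃ T', Admissible c M r₀ r₁ D s₀ s₁ T' ∧ totalWeight T' < totalWeight T := by
  have hT : ∑' n, ((T n).2 : ℝ≥0∞) ≠ ⊤ := ne_top_of_le_ne_top hD h.tsum_le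
  set u := (T m).2
  set v := (T n).2
  have hu : (0 : ℝ) < u := hm
  have hv : (0 : ℝ) < v := hn
  set l : ℝ := v / (u + v) with hl
  have hl0 : 0 ≤ l := by positivity
  have hl1 : 0 ≤ 1 - l := by
    rw [hl, one_sub_div (by positivity)]
    simp only [add_sub_cancel_right]
    positivity
  have hlu : l * (u + v) = v := by rw [hl]; field_simp
  set w : ℂ := (1 - l) • (T m).1 + l • (T n).1 with hw
  have hw1 : dist (T m).1 w ≤ v := by
    have : (T m).1 - w = l • ((T m).1 - (T n).1) := by rw [hw]; module
    rw [dist_eq_norm, this, norm_smul, Real.norm_of_nonneg hl0, ← dist_eq_norm]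
    calc l * dist (T m).1 (T n).1 ≤ l * (u + v) := by gcongr
      _ = v := hlu
  have hw2 : dist (T n).1 w ≤ u := by
    have : (T n).1 - w = (1 - l) • ((T n).1 - (T m).1) := by rw [hw]; module
    rw [dist_eq_norm, this, norm_smul, Real.norm_of_nonneg hl1, ← dist_eq_norm, dist_comm]
    calc (1 - l) * dist (T m).1 (T n).1 ≤ (1 - l) * (u + v) := by gcongr
      _ = u := by linarith
  have hwM : ‖w‖ ≤ M := by
    refine (norm_add_le _ _).trans ?_
    rw [norm_smul, norm_smul, Real.norm_of_nonneg hl0, Real.norm_of_nonneg hl1]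
    calc (1 - l) * ‖(T m).1‖ + l * ‖(T n).1‖ ≤ (1 - l) * M + l * M := by
          gcongr
          exacts [h.norm_le m, h.norm_le n]
      _ = M := by ring
  set S : ℕ → ℂ × NNReal := fun i => T (skip n (skip m i)) with hS
  have hsplit (g : ℂ × NNReal → ℝ≥0∞) : ∑' i, g (T i) = g (T n) + (g (T m) + ∑' i, g (S i)) := by
    rw [tsum_eq_add_tsum_skip _ n, tsum_eq_add_tsum_skip (fun i => g (T (skip n i))) m,
      skip_of_lt hmn]
  have hSanti : Antitone fun i => (S i).2 :=
    h.anti.comp_monotone ((skip_mono n).comp (skip_mono m))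
  have hSsum : ∑' i, ((S i).2 : ℝ≥0∞) ≠ ⊤ := by
    refine ne_top_of_le_ne_top hT ?_
    rw [hsplit fun x => x.2, ← add_assoc]
    exact le_add_self
  obtain ⟨k, T', hk, hT', hanti⟩ := exists_insert_antitone hSanti hSsum (x := (w, u + v))
    (by positivity)
  have hsplit' (g : ℂ × NNReal → ℝ≥0∞) : ∑' i, g (T' i) = g (w, u + v) + ∑' i, g (S i) := by
    rw [tsum_eq_add_tsum_skip _ k]
    simp only [hk, hT']
  refine ⟨T', ⟨hanti, fun i => ?_, h.outer_le, h.le_inner, ?_, fun i hi => ?_⟩, ?_⟩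
  · rcases eq_or_ne i k with rfl | hik
    · rw [hk]
      exact hwM
    · obtain ⟨j, rfl⟩ := exists_skip_eq hik
      rw [hT']
      exact h.norm_le _
  · have : ∑' i, ((T' i).2 : ℝ≥0∞) = ∑' i, ((T i).2 : ℝ≥0∞) := by
      rw [hsplit fun x => x.2, hsplit' fun x => x.2]
      push_cast
      ring
    rw [this]
    exact h.sum_le
  · rcases h.covers i hi with h' | h' | ⟨j, hj⟩
    · exact .inl h'
    · exact .inr (.inl h')
    · refine .inr (.inr ?_)
      rcases eq_or_ne j n with rfl | hjn
      · refine ⟨k, ?_⟩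
        have := dist_triangle (D i).1 (T j).1 w
        rw [hk]
        push_cast
        linarith
      · obtain ⟨j, rfl⟩ := exists_skip_eq hjn
        rcases eq_or_ne j m with rfl | hjm
        · refine ⟨k, ?_⟩
          rw [skip_of_lt hmn] at hj
          have := dist_triangle (D i).1 (T j).1 w
          rw [hk]
          push_cast
          linarith
        · obtain ⟨j, rfl⟩ := exists_skip_eq hjm
          exact ⟨skip k j, by rwa [hT']⟩
  · have hfin : ∑' i, (weight (S i).2 : ℝ≥0∞) ≠ ⊤ :=
      ne_top_of_le_ne_top hSsum (totalWeight_le S)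
    unfold totalWeight
    rw [hsplit fun x => weight x.2, hsplit' fun x => weight x.2, ← add_assoc]
    refine ENNReal.add_lt_add_right hfin ?_
    rw [add_comm (weight (T n).2 : ℝ≥0∞)]
    exact_mod_cast weight_add_lt hm hn

end Admissible

section Compactness

variable (c : ℂ) (M r₀ r₁ : NNReal) (D : ℕ → ℂ × NNReal)

/-- The admissible triples `(s₀, s₁, T)` as a subset of a product space. -/
def admissibleSet : Set ((NNReal × NNReal) × (ℕ → ℂ × NNReal)) :=
  {p | Admissible c M r₀ r₁ D p.1.1 p.1.2 p.2}

variable {c M r₀ r₁ D}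

/-- Only boundedly many disks of an admissible sequence are large enough to contain a given
disk. -/
lemma Admissible.exists_bound (hD : ∑' n, ((D n).2 : ℝ≥0∞) ≠ ⊤) {x : ℂ × NNReal}
    (hx : 0 < x.2) :
    ∃ L : ℕ, ∀ s₀ s₁ T, Admissible c M r₀ r₁ D s₀ s₁ T → ∀ m,
      (dist x.1 (T m).1 + x.2 : ℝ) ≤ (T m).2 → m < L := by
  obtain ⟨L, hL⟩ := ENNReal.exists_nat_mul_gt (ENNReal.coe_pos.2 hx).ne' hD
  refine ⟨L, fun s₀ s₁ T h m hm => ?_⟩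
  by_contra! hLm
  have hxm : x.2 ≤ (T m).2 := by
    have : (x.2 : ℝ) ≤ (T m).2 := by linarith [dist_nonneg (x := x.1) (y := (T m).1)]
    exact_mod_cast this
  have h1 := (succ_mul_le_tsum h.anti m).trans h.tsum_le
  refine absurd (hL.trans_le' h1) (not_lt.2 ?_)
  gcongr
  omega

lemma isClosed_setOf_add_tsum_add_le {X : Type*} [TopologicalSpace X] {a b d : X → ℝ≥0∞}
    {f : ℕ → X → ℝ≥0∞} (ha : Continuous a) (hb : Continuous b) (hd : Continuous d)
    (hf : ∀ n, Continuous (f n)) :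
    IsClosed {x | a x + 2 * ∑' n, f n x + b x ≤ d x} := by
  have : {x | a x + 2 * ∑' n, f n x + b x ≤ d x} =
      ⋂ N : ℕ, {x | a x + 2 * ∑ n ∈ Finset.range N, f n x + b x ≤ d x} := by
    ext x
    simp only [mem_ofPred_eq, mem_iInter]
    refine ⟨fun h N => le_trans ?_ h, fun h => ?_⟩
    · gcongr
      exact ENNReal.sum_le_tsum _
    · have hlim : Tendsto (fun N : ℕ => 2 * ∑ n ∈ Finset.range N, f n x) atTop
          (𝓝 (2 * ∑' n, f n x)) :=
        ENNReal.Tendsto.const_mul (ENNReal.tendsto_nat_tsum _) (.inr (by simp))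
      exact le_of_tendsto' ((tendsto_const_nhds.add hlim).add tendsto_const_nhds) h
  rw [this]
  refine isClosed_iInter fun N => isClosed_le ?_ hd
  refine (ha.add ?_).add hb
  exact (ENNReal.continuous_const_mul (by simp)).comp (continuous_finsetSum _ fun n _ => hf n)

lemma isClosed_admissibleSet (hD : ∑' n, ((D n).2 : ℝ≥0∞) ≠ ⊤) :
    IsClosed (admissibleSet c M r₀ r₁ D) := by
  choose! L hL using fun (n : ℕ) (hn : 0 < (D n).2) =>
    Admissible.exists_bound (c := c) (M := M) (r₀ := r₀) (r₁ := r₁) hD hn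
  have hT (n : ℕ) : Continuous fun p : (NNReal × NNReal) × (ℕ → ℂ × NNReal) => p.2 n :=
    (continuous_apply n).comp continuous_snd
  have hc (n : ℕ) : Continuous fun p : (NNReal × NNReal) × (ℕ → ℂ × NNReal) => (p.2 n).1 :=
    continuous_fst.comp (hT n)
  have hr (n : ℕ) : Continuous fun p : (NNReal × NNReal) × (ℕ → ℂ × NNReal) => (p.2 n).2 :=
    continuous_snd.comp (hT n)
  have heq : admissibleSet c M r₀ r₁ D =
      (⋂ n, {p | (p.2 (n + 1)).2 ≤ (p.2 n).2}) ∩ ((⋂ n, {p | ‖(p.2 n).1‖ ≤ M}) ∩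
      ({p | p.1.1 ≤ r₀} ∩ ({p | r₁ ≤ p.1.2} ∩
      ({p | (p.1.2 : ℝ≥0∞) + 2 * ∑' n, ((p.2 n).2 : ℝ≥0∞) + r₀ ≤
        p.1.1 + (r₁ + 2 * ∑' n, ((D n).2 : ℝ≥0∞))} ∩
      ⋂ n, ⋂ (_ : 0 < (D n).2), ({p | ((D n).2 + p.1.1 : ℝ) ≤ dist (D n).1 c} ∪
        ({p | (dist (D n).1 c + (D n).2 : ℝ) ≤ p.1.2} ∪
        ⋃ m ∈ Iio (L n), {p | (dist (D n).1 (p.2 m).1 + (D n).2 : ℝ) ≤ (p.2 m).2})))))) := by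
    ext p
    simp only [admissibleSet, mem_inter_iff, mem_iInter, mem_ofPred_eq, mem_union, mem_iUnion,
      mem_Iio, exists_prop]
    constructor
    · intro h
      refine ⟨fun n => h.anti n.le_succ, h.norm_le, h.outer_le, h.le_inner, h.sum_le,
        fun n hn => ?_⟩
      rcases h.covers n hn with h' | h' | ⟨m, hm⟩
      exacts [.inl h', .inr (.inl h'), .inr (.inr ⟨m, hL n hn _ _ _ h m hm, hm⟩)]
    · rintro ⟨h1, h2, h3, h4, h5, h6⟩
      refine ⟨antitone_nat_of_succ_le h1, h2, h3, h4, h5, fun n hn => ?_⟩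
      rcases h6 n hn with h' | h' | ⟨m, -, hm⟩
      exacts [.inl h', .inr (.inl h'), .inr (.inr ⟨m, hm⟩)]
  rw [heq]
  refine .inter (isClosed_iInter fun n => isClosed_le (hr _) (hr _)) <|
    .inter (isClosed_iInter fun n => isClosed_le (hc n).norm continuous_const) <|
    .inter (isClosed_le (by fun_prop) continuous_const) <|
    .inter (isClosed_le continuous_const (by fun_prop)) <| .inter ?_ <|
    isClosed_iInter fun n => isClosed_iInter fun _ =>
    .union (isClosed_le (by fun_prop) continuous_const) <|
    .union (isClosed_le continuous_const (by fun_prop)) <|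
    (finite_Iio _).isClosed_biUnion fun m _ => isClosed_le ?_ ?_
  · exact isClosed_setOf_add_tsum_add_le
      (ENNReal.continuous_coe.comp (by fun_prop)) continuous_const
      ((ENNReal.continuous_coe.comp (by fun_prop)).add continuous_const)
      fun n => ENNReal.continuous_coe.comp (hr n)
  · exact (continuous_const.dist (hc m)).add continuous_const
  · exact NNReal.continuous_coe.comp (hr m)

lemma isCompact_admissibleSet (hD : ∑' n, ((D n).2 : ℝ≥0∞) ≠ ⊤) :
    IsCompact (admissibleSet c M r₀ r₁ D) := by
  set d : NNReal := (∑' n, ((D n).2 : ℝ≥0∞)).toNNReal with hd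
  have hd' : (d : ℝ≥0∞) = ∑' n, ((D n).2 : ℝ≥0∞) := ENNReal.coe_toNNReal hD
  have hK : IsCompact ((Icc 0 r₀ ×ˢ Icc 0 (r₁ + 2 * d)) ×ˢ
      Set.univ.pi fun _ : ℕ => closedBall (0 : ℂ) M ×ˢ Icc 0 d) :=
    (isCompact_Icc.prod isCompact_Icc).prod
      (isCompact_univ_pi fun _ => (isCompact_closedBall _ _).prod isCompact_Icc)
  refine hK.of_isClosed_subset (isClosed_admissibleSet hD) fun p hp => ?_
  have hp' : Admissible c M r₀ r₁ D p.1.1 p.1.2 p.2 := hp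
  refine ⟨⟨⟨zero_le, hp'.outer_le⟩, zero_le, ?_⟩, fun n _ => ⟨?_, zero_le, ?_⟩⟩
  · have h0 : (p.1.1 : ℝ≥0∞) ≤ r₀ := by exact_mod_cast hp'.outer_le
    have h1 : (p.1.2 : ℝ≥0∞) + r₀ ≤ (r₁ + 2 * d) + r₀ := by
      calc (p.1.2 : ℝ≥0∞) + r₀ ≤ p.1.2 + 2 * ∑' n, ((p.2 n).2 : ℝ≥0∞) + r₀ := by
            gcongr
            exact le_self_add
        _ ≤ _ := hp'.sum_le
        _ ≤ r₀ + (r₁ + 2 * d) := by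
            rw [hd']
            gcongr
        _ = _ := add_comm _ _
    have h2 : p.1.2 + r₀ ≤ (r₁ + 2 * d) + r₀ := by exact_mod_cast h1
    exact le_of_add_le_add_right h2
  · simpa using hp'.norm_le n
  · have : ((p.2 n).2 : ℝ≥0∞) ≤ d := by
      rw [hd']
      exact (ENNReal.le_tsum n).trans hp'.tsum_le
    exact_mod_cast this

end Compactness

/-- An admissible competitor in which all the closed disks are separated. -/
lemma exists_separated_admissible {c : ℂ} {M r₀ r₁ : NNReal} {D : ℕ → ℂ × NNReal}
    (hanti : Antitone fun n => (D n).2) (hM : ∀ n, ‖(D n).1‖ ≤ M)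
    (hD : ∑' n, ((D n).2 : ℝ≥0∞) ≠ ⊤)
    (hpos : (r₁ : ℝ) + 2 * (∑' n, ((D n).2 : ℝ≥0∞)).toReal < r₀) :
    ∃ s₀ s₁ T, Admissible c M r₀ r₁ D s₀ s₁ T ∧
      (∀ n, 0 < (T n).2 → dist (T n).1 c + (T n).2 < s₀) ∧
      (∀ n, 0 < (T n).2 → s₁ + (T n).2 < dist (T n).1 c) ∧
      ∀ m n, m ≠ n → 0 < (T m).2 → 0 < (T n).2 →
        ((T m).2 + (T n).2 : ℝ) < dist (T m).1 (T n).1 := by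
  obtain ⟨⟨⟨s₀, s₁⟩, T⟩, hmem, hmin⟩ := LowerSemicontinuousOn.exists_isMinOn
    ⟨((r₀, r₁), D), Admissible.refl hanti hM⟩ (isCompact_admissibleSet hD)
    ((lowerSemicontinuous_totalWeight.comp continuous_snd).lowerSemicontinuousOn _)
  have h : Admissible c M r₀ r₁ D s₀ s₁ T := hmem
  have hle {s₀' s₁' T'} (h' : Admissible c M r₀ r₁ D s₀' s₁' T') :
      totalWeight T ≤ totalWeight T' := hmin (a := ((s₀', s₁'), T')) h'
  have hT : ∑' n, ((T n).2 : ℝ≥0∞) ≠ ⊤ := ne_top_of_le_ne_top hD h.tsum_le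
  have hnot {s₀' s₁'} (k : ℕ) (hk : 0 < (T k).2)
      (h' : Admissible c M r₀ r₁ D s₀' s₁' fun n => T (skip k n)) : False := by
    have hfin : totalWeight (fun n => T (skip k n)) ≠ ⊤ := by
      refine ne_top_of_le_ne_top (ne_top_of_le_ne_top hT (totalWeight_le T)) ?_
      rw [totalWeight_eq_add_skip T k]
      exact le_add_self
    have h1 := hle h'
    rw [totalWeight_eq_add_skip T k] at h1
    refine absurd h1 (not_le.2 ?_)
    rw [add_comm]
    exact ENNReal.lt_add_right hfin (by simpa using (weight_pos hk).ne')
  have hgap (n : ℕ) : (s₁ : ℝ) + 2 * (T n).2 < s₀ := by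
    have h1 := h.toReal_sum_le hD
    have h2 : ((T n).2 : ℝ) ≤ (∑' n, ((T n).2 : ℝ≥0∞)).toReal :=
      ENNReal.toReal_mono hT (ENNReal.le_tsum (f := fun n => ((T n).2 : ℝ≥0∞)) n)
    linarith
  refine ⟨s₀, s₁, T, h, fun n hn => ?_, fun n hn => ?_, fun m n hmn hm hn => ?_⟩
  · by_contra! hcon
    have h1 := hgap n
    have h0 : (0 : ℝ) ≤ s₁ := s₁.coe_nonneg
    obtain ⟨t, ht⟩ : ∃ t : NNReal, (t : ℝ) = dist (T n).1 c - (T n).2 :=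
      ⟨⟨_, by linarith⟩, rfl⟩
    refine hnot n hn (h.absorb n (s₀' := min s₀ t) (min_le_left _ _) le_rfl ?_ ?_)
    · rw [← NNReal.coe_le_coe]
      rcases min_choice s₀ t with h' | h' <;> rw [h'] <;> push_cast <;>
        linarith [(T n).2.coe_nonneg]
    · intro x hx
      left
      have h2 : ((min s₀ t : NNReal) : ℝ) ≤ t := NNReal.coe_le_coe.2 (min_le_right _ _)
      linarith [dist_triangle_left (T n).1 c x.1]
  · by_contra! hcon
    obtain ⟨t, ht⟩ : ∃ t : NNReal, (t : ℝ) = dist (T n).1 c + (T n).2 :=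
      ⟨⟨_, by positivity⟩, rfl⟩
    refine hnot n hn (h.absorb n (s₁' := max s₁ t) le_rfl (le_max_left _ _) ?_ ?_)
    · rw [← NNReal.coe_le_coe]
      rcases max_choice s₁ t with h' | h' <;> rw [h'] <;> push_cast <;>
        linarith [(T n).2.coe_nonneg]
    · intro x hx
      right
      have h2 : (t : ℝ) ≤ (max s₁ t : NNReal) := NNReal.coe_le_coe.2 (le_max_right _ _)
      linarith [dist_triangle x.1 (T n).1 c]
  · by_contra! hcon
    rcases lt_or_gt_of_ne hmn with hlt | hlt
    · obtain ⟨T', h', hw⟩ := h.exists_merge hD hlt hm hn hcon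
      exact absurd (hle h') (not_le.2 hw)
    · obtain ⟨T', h', hw⟩ := h.exists_merge hD hlt hn hm (by rwa [dist_comm, add_comm])
      exact absurd (hle h') (not_le.2 hw)

lemma PartiallyAbove.xset_subset {A B : ASC} (h : PartiallyAbove B A) : Xset B ⊆ Xset A := by
  rintro z ⟨hz, hzB⟩
  refine ⟨h.1 hz, fun hzA => hzB ?_⟩
  obtain ⟨n, hn⟩ := mem_iUnion.1 hzA
  rcases h.2 (n + 1) n.succ_pos with h' | ⟨m, hm, h'⟩
  · exact absurd hz (h' hn)
  · obtain ⟨m, rfl⟩ := Nat.exists_eq_add_of_le' hm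
    exact mem_iUnion.2 ⟨m, h' hn⟩

lemma rhoAnn_ne_top_of_deltaAnn_pos {A : ASC} (h : 0 < deltaAnn A) : rhoAnn A ≠ ⊤ := by
  intro htop
  simp [deltaAnn, htop] at h

lemma deltaAnn_eq_coe {A : ASC} (h : rhoAnn A ≠ ⊤) :
    deltaAnn A = ((rad A 0 - rad A 1 - 2 * (rhoAnn A).toReal : ℝ) : EReal) := by
  unfold deltaAnn
  lift rhoAnn A to NNReal using h with t
  rfl

/-- The abstract Swiss cheese with outer disk of radius `s₀` about `c`, first removed disk of
radius `s₁` about `c` and remaining disks `T`. -/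
def annularCheese (c : ℂ) (s₀ s₁ : NNReal) (T : ℕ → ℂ × NNReal) : ASC
  | 0 => (c, s₀)
  | 1 => (c, s₁)
  | n + 2 => T n

lemma isClassicalASC_annularCheese {c : ℂ} {s₀ s₁ : NNReal} {T : ℕ → ℂ × NNReal}
    (hsum : ∑' n, ((T n).2 : ℝ≥0∞) ≠ ⊤) (hs : s₁ < s₀)
    (hout : ∀ n, 0 < (T n).2 → dist (T n).1 c + (T n).2 < s₀)
    (hin : ∀ n, 0 < (T n).2 → s₁ + (T n).2 < dist (T n).1 c)
    (hsep : ∀ m n, m ≠ n → 0 < (T m).2 → 0 < (T n).2 →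
      ((T m).2 + (T n).2 : ℝ) < dist (T m).1 (T n).1) :
    IsClassicalASC (annularCheese c s₀ s₁ T) := by
  refine ⟨?_, ?_, ?_⟩
  · have : rhoSum (annularCheese c s₀ s₁ T) = s₁ + ∑' n, ((T n).2 : ℝ≥0∞) :=
      tsum_eq_zero_add' (f := fun n => ((annularCheese c s₀ s₁ T (n + 1)).2 : ℝ≥0∞))
        ENNReal.summable
    rw [this]
    finiteness
  · exact NNReal.coe_pos.2 (zero_le.trans_lt hs)
  · rintro (_ | _ | k) ⟨hk, hk'⟩
    · omega
    · refine ⟨closedBall_subset_ball (NNReal.coe_lt_coe.2 hs), ?_⟩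
      rintro (_ | _ | l) ⟨hl, hl'⟩ hne
      · omega
      · omega
      · refine (closedBall_disjoint_closedBall ?_).inter_eq
        rw [dist_comm]
        exact hin l (NNReal.coe_pos.1 hl')
    · refine ⟨closedBall_subset_ball' ?_, ?_⟩
      · rw [add_comm]
        exact hout k (NNReal.coe_pos.1 hk')
      rintro (_ | _ | l) ⟨hl, hl'⟩ hne
      · omega
      · refine (closedBall_disjoint_closedBall ?_).inter_eq
        rw [add_comm]
        exact hin k (NNReal.coe_pos.1 hk')
      · exact (closedBall_disjoint_closedBall (hsep k l (by omega) (NNReal.coe_pos.1 hk')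
          (NNReal.coe_pos.1 hl'))).inter_eq

lemma Admissible.partiallyAbove {A : ASC} {M s₀ s₁ : NNReal} {T : ℕ → ℂ × NNReal}
    (hA : ctr A 0 = ctr A 1)
    (h : Admissible (ctr A 0) M (A 0).2 (A 1).2 (fun n => A (n + 2)) s₀ s₁ T) :
    PartiallyAbove (annularCheese (ctr A 0) s₀ s₁ T) A := by
  refine ⟨closedBall_subset_closedBall (NNReal.coe_le_coe.2 h.outer_le), ?_⟩
  rintro (_ | _ | n) hn
  · omega
  · refine .inr ⟨1, le_rfl, ?_⟩
    change ball (ctr A 1) _ ⊆ ball (ctr A 0) _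
    rw [hA]
    exact ball_subset_ball (NNReal.coe_le_coe.2 h.le_inner)
  · rcases eq_or_ne (A (n + 2)).2 0 with h0 | h0
    · refine .inr ⟨1, le_rfl, ?_⟩
      have : rad A (n + 2) = 0 := by simp [rad, h0]
      simp [this]
    · rcases h.covers n (pos_iff_ne_zero.2 h0) with h' | h' | ⟨m, hm⟩
      · left
        refine fun z hz hz' => ?_
        have h1 : dist z (A (n + 2)).1 < (A (n + 2)).2 := hz
        have h2 : dist z (ctr A 0) ≤ s₀ := hz'
        linarith [dist_triangle_left (A (n + 2)).1 (ctr A 0) z]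
      · refine .inr ⟨1, le_rfl, ball_subset_ball' ?_⟩
        rw [add_comm]
        exact h'
      · refine .inr ⟨m + 2, by omega, ball_subset_ball' ?_⟩
        rw [add_comm]
        exact hm

/-- **Annular classicalisation theorem** (Theorem 6.6). -/
theorem stmt18 (A : ASC) (hann : Annular A) (hd : 0 < deltaAnn A)
    (hmu : muSup A < ⊤) (hmono : ∀ n : ℕ, 2 ≤ n → (A (n + 1)).2 ≤ (A n).2) :
    ∃ B ∈ ATilde A, Annular B ∧ IsClassicalASC B ∧ deltaAnn A ≤ deltaAnn B ∧
      Xset B ⊆ Xset A ∧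
      rad A 0 - 2 * (rhoAnn A).toReal ≤ rad B 0 ∧ rad B 0 ≤ rad A 0 ∧
      rad A 1 ≤ rad B 1 ∧ rad B 1 ≤ rad A 1 + 2 * (rhoAnn A).toReal := by
  have hfin := rhoAnn_ne_top_of_deltaAnn_pos hd
  have hdA := deltaAnn_eq_coe hfin
  have hpos : 0 < rad A 0 - rad A 1 - 2 * (rhoAnn A).toReal := by
    rw [hdA] at hd
    exact_mod_cast hd
  have hM (n : ℕ) : ‖(A (n + 1)).1‖₊ ≤ (muSup A).toNNReal := by
    rw [← ENNReal.coe_le_coe, ENNReal.coe_toNNReal hmu.ne]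
    exact le_iSup (fun n => (‖(A (n + 1)).1‖₊ : ℝ≥0∞)) n
  obtain ⟨s₀, s₁, T, h, hout, hin, hsep⟩ := exists_separated_admissible (c := ctr A 0)
    (M := (muSup A).toNNReal) (r₀ := (A 0).2) (r₁ := (A 1).2) (D := fun n => A (n + 2))
    (antitone_nat_of_succ_le fun n => hmono (n + 2) (by omega)) (fun n => hM (n + 1)) hfin
    (by linarith! [hpos])
  have hsum : (s₁ : ℝ) + 2 * (∑' n, ((T n).2 : ℝ≥0∞)).toReal + rad A 0 ≤
    s₀ + (rad A 1 + 2 * (rhoAnn A).toReal) := h.toReal_sum_le hfin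
  have hT : ∑' n, ((T n).2 : ℝ≥0∞) ≠ ⊤ := ne_top_of_le_ne_top hfin h.tsum_le
  have hT0 : 0 ≤ (∑' n, ((T n).2 : ℝ≥0∞)).toReal := ENNReal.toReal_nonneg
  have hs0 : (s₀ : ℝ) ≤ rad A 0 := NNReal.coe_le_coe.2 h.outer_le
  have hs1 : rad A 1 ≤ s₁ := NNReal.coe_le_coe.2 h.le_inner
  have hlt : (s₁ : ℝ) < s₀ := by linarith
  have habove := h.partiallyAbove hann.1
  refine ⟨annularCheese (ctr A 0) s₀ s₁ T,
    ⟨?_, h.tsum_le, ?_, habove, rfl, rfl, hs1, hlt.le, hs0⟩,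
    ⟨rfl, hann.2.1.trans_le hs1, hlt⟩, isClassicalASC_annularCheese hT hlt hout hin hsep, ?_,
    habove.xset_subset, ?_, hs0, hs1, ?_⟩
  · intro n hn
    obtain ⟨n, rfl⟩ := Nat.exists_eq_add_of_le' hn
    exact h.anti n.le_succ
  · refine iSup_le fun n => ?_
    rw [← ENNReal.coe_toNNReal hmu.ne, ENNReal.coe_le_coe]
    rcases n with _ | n
    · change ‖ctr A 0‖₊ ≤ _
      rw [hann.1]
      exact hM 0
    · exact h.norm_le n
  · rw [hdA, deltaAnn_eq_coe (A := annularCheese _ _ _ _) hT, EReal.coe_le_coe_iff]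
    change _ ≤ (s₀ : ℝ) - s₁ - 2 * (∑' n, ((T n).2 : ℝ≥0∞)).toReal
    linarith
  · change _ ≤ (s₀ : ℝ)
    linarith
  · change (s₁ : ℝ) ≤ _
    linarith

end
end

section
/- Let X be a non-empty compact subset of ℂ and let E be a countable subset of X. Let (X_α) be a family of non-empty compact subsets of ℂ such that R(X_α) is regular for every α and ⋃_α int_X(X ∩ X_α) ⊇ X \ E, where int_X denotes interior relative to the subspace topology on X. Then R(X) is regular. -/
open Metric Set Filter Topology ENNReal

noncomputable section

/-- `R(X)`: the closure in `C(X, ℂ)` of the restrictions to `X` of rational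
functions with no poles on `X`. -/
def RX (X : Set ℂ) : Set C(X, ℂ) :=
  closure {f : C(X, ℂ) | ∃ p q : Polynomial ℂ, (∀ z ∈ X, q.eval z ≠ 0) ∧
    ∀ z : X, f z = p.eval (z : ℂ) / q.eval (z : ℂ)}

/-- `R(X)` is regular: points can be separated from disjoint closed sets by
functions in `R(X)`. -/
def RXRegular (X : Set ℂ) : Prop :=
  ∀ E : Set ℂ, IsClosed E → E ⊆ X → ∀ x : ℂ, ∀ hx : x ∈ X, x ∉ E →
    ∃ f ∈ RX X, f ⟨x, hx⟩ = 1 ∧ ∀ y : ℂ, ∀ hy : y ∈ X, y ∈ E → f ⟨y, hy⟩ = 0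

/-- The algebra of restrictions to `X` of rational functions without poles on `X`. -/
def ratSubalgebra (X : Set ℂ) : Subalgebra ℂ C(X, ℂ) where
  carrier := {f : C(X, ℂ) | ∃ p q : Polynomial ℂ, (∀ z ∈ X, q.eval z ≠ 0) ∧
    ∀ z : X, f z = p.eval (z : ℂ) / q.eval (z : ℂ)}
  mul_mem' := by
    rintro f g ⟨p, q, hq, hf⟩ ⟨p', q', hq', hg⟩
    refine ⟨p * p', q * q', fun z hz => ?_, fun z => ?_⟩
    · rw [Polynomial.eval_mul]
      exact mul_ne_zero (hq z hz) (hq' z hz)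
    · simp [hf z, hg z, div_mul_div_comm]
  add_mem' := by
    rintro f g ⟨p, q, hq, hf⟩ ⟨p', q', hq', hg⟩
    refine ⟨p * q' + q * p', q * q', fun z hz => ?_, fun z => ?_⟩
    · rw [Polynomial.eval_mul]
      exact mul_ne_zero (hq z hz) (hq' z hz)
    · simp [hf z, hg z, div_add_div _ _ (hq z z.2) (hq' z z.2)]
  algebraMap_mem' c := ⟨Polynomial.C c, 1, by simp, by simp⟩

/-- The closed subalgebra of `C(X, ℂ)` whose underlying set is `RX X`. -/
def RXAlgebra (X : Set ℂ) [CompactSpace X] : Subalgebra ℂ C(X, ℂ) :=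
  (ratSubalgebra X).topologicalClosure

instance (X : Set ℂ) [CompactSpace X] : CompleteSpace (RXAlgebra X) :=
  (Subalgebra.isClosed_topologicalClosure (ratSubalgebra X)).completeSpace_coe

/-- The coordinate function, as an element of `R(X)`. -/
def coordRX (X : Set ℂ) [CompactSpace X] : RXAlgebra X :=
  ⟨⟨Subtype.val, continuous_subtype_val⟩,
    subset_closure ⟨Polynomial.X, 1, by simp, by simp⟩⟩

/-- The function `w ↦ (a - w)⁻¹` lies in `R(X)` when `a ∉ X`. -/
lemma inv_sub_mem_RX {X : Set ℂ} {a : ℂ} (ha : a ∉ X) {f : C(X, ℂ)}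
    (hf : ∀ w : X, f w = (a - w)⁻¹) : f ∈ RX X := by
  refine subset_closure ⟨1, Polynomial.C a - Polynomial.X, fun z hz => ?_, fun z => ?_⟩
  · simpa [sub_eq_zero] using fun h : a = z => ha (h ▸ hz)
  · simp [hf z]

lemma RXAlgebra_character_coe {X : Set ℂ} [CompactSpace X] (χ : RXAlgebra X →ₐ[ℂ] ℂ)
    (hχ : Continuous χ) : ∃ a : X, ∀ f : RXAlgebra X, χ f = f.1 a := by
  set a := χ (coordRX X) with ha
  have haX : a ∈ X := by
    by_contra hn
    have hne : ∀ w : X, a - w ≠ 0 := fun w h => hn (by rw [sub_eq_zero.1 h]; exact w.2)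
    let u : RXAlgebra X := ⟨⟨fun w => (a - w)⁻¹,
      (continuous_const.sub continuous_subtype_val).inv₀ hne⟩,
      inv_sub_mem_RX hn fun _ => rfl⟩
    have h1 : u * (algebraMap ℂ _ a - coordRX X) = 1 := by
      ext w
      exact inv_mul_cancel₀ (hne w)
    have h2 := congrArg χ h1
    simp only [map_mul, map_sub, map_one, AlgHom.commutes, ← ha] at h2
    simp at h2
  refine ⟨⟨a, haX⟩, ?_⟩
  have hpoly : ∀ p : Polynomial ℂ, χ (Polynomial.aeval (coordRX X) p) = p.eval a := by
    intro p
    rw [← Polynomial.aeval_algHom_apply, ← ha, Polynomial.coe_aeval_eq_eval]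
  have hval : ∀ (p : Polynomial ℂ) (w : X),
      (Polynomial.aeval (coordRX X) p).1 w = p.eval (w : ℂ) := by
    intro p w
    have := Polynomial.aeval_algHom_apply
      (((ContinuousMap.evalAlgHom ℂ ℂ w)).comp (RXAlgebra X).val) (coordRX X) p
    rw [← Polynomial.coe_aeval_eq_eval]
    exact this.symm
  have hcl : IsClosed {f : RXAlgebra X | χ f = f.1 ⟨a, haX⟩} :=
    isClosed_eq hχ ((continuous_eval_const _).comp continuous_subtype_val)
  intro f
  have hd : Dense {f : RXAlgebra X | f.1 ∈ ratSubalgebra X} := by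
    intro f
    rw [closure_subtype]
    refine closure_mono ?_ f.2
    intro g hg
    exact ⟨⟨g, subset_closure hg⟩, hg, rfl⟩
  refine hcl.closure_subset_iff.2 ?_ (hd f)
  rintro g ⟨p, q, hq, hg⟩
  have h1 : g * Polynomial.aeval (coordRX X) q = Polynomial.aeval (coordRX X) p := by
    ext w
    have : (g * Polynomial.aeval (coordRX X) q).1 w
      = g.1 w * (Polynomial.aeval (coordRX X) q).1 w := rfl
    refine this.trans ?_
    rw [hg w, hval, hval, div_mul_cancel₀ _ (hq w w.2)]
  have h2 := congrArg χ h1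
  rw [map_mul, hpoly, hpoly] at h2
  change χ g = g.1 ⟨a, haX⟩
  rw [hg, eq_div_iff (hq a haX), h2]

/-- The ideal of functions in `R(X)` vanishing on `F`. -/
def vanishingIdeal (X : Set ℂ) [CompactSpace X] (F : Set ℂ) : Ideal (RXAlgebra X) where
  carrier := {f | ∀ y : X, (y : ℂ) ∈ F → f.1 y = 0}
  add_mem' hf hg y hy := by
    have h := congrArg₂ (· + ·) (hf y hy) (hg y hy)
    exact h.trans (add_zero 0)
  zero_mem' _ _ := rfl
  smul_mem' c f hf y hy := by
    have h := congrArg (c.1 y * ·) (hf y hy)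
    exact h.trans (mul_zero _)

/-- If `R(X)` is regular, then it is normal. -/
lemma RXRegular.exists_zero_one {X : Set ℂ} (hX : IsCompact X) (h : RXRegular X)
    {F L : Set ℂ} (hF : IsClosed F) (hL : IsClosed L) (hFL : Disjoint F L) :
    ∃ f ∈ RX X, (∀ y : X, (y : ℂ) ∈ F → f y = 0) ∧ ∀ y : X, (y : ℂ) ∈ L → f y = 1 := by
  have : CompactSpace X := isCompact_iff_compactSpace.1 hX
  have htop : vanishingIdeal X F ⊔ vanishingIdeal X L = ⊤ := by
    by_contra hne
    obtain ⟨M, hM, hle⟩ := Ideal.exists_le_maximal _ hne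
    obtain ⟨a, ha⟩ := RXAlgebra_character_coe
      (WeakDual.CharacterSpace.equivAlgHom M.toCharacterSpace)
      (map_continuous M.toCharacterSpace)
    have key : ∀ G : Set ℂ, IsClosed G → (a : ℂ) ∉ G → vanishingIdeal X G ≤ M → False := by
      intro G hG haG hGM
      obtain ⟨f, hf, hf1, hf0⟩ := h (G ∩ X) (hG.inter hX.isClosed) inter_subset_right a a.2
        fun h => haG h.1
      have hfM : (⟨f, hf⟩ : RXAlgebra X) ∈ M := hGM fun y hy => hf0 y y.2 ⟨hy, y.2⟩
      have h0 := M.toCharacterSpace_apply_eq_zero_of_mem hfM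
      have h1 := ha ⟨f, hf⟩
      exact one_ne_zero (hf1.symm.trans (h1.symm.trans h0))
    by_cases haF : (a : ℂ) ∈ F
    · exact key L hL (disjoint_left.1 hFL haF) (le_sup_right.trans hle)
    · exact key F hF haF (le_sup_left.trans hle)
  have h1 : (1 : RXAlgebra X) ∈ vanishingIdeal X F ⊔ vanishingIdeal X L := htop ▸ trivial
  obtain ⟨f, hf, g, hg, hfg⟩ := Submodule.mem_sup.1 h1
  refine ⟨f.1, f.2, hf, fun y hy => ?_⟩
  have h2 : f.1 y + g.1 y = 1 := congrArg (fun k : RXAlgebra X => k.1 y) hfg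
  rwa [hg y hy, add_zero] at h2

/-- Twice the Cauchy–Riemann derivative `∂G/∂z̄`. -/
def crDeriv (G : ℂ → ℂ) (z : ℂ) : ℂ := fderiv ℝ G z 1 + Complex.I * fderiv ℝ G z Complex.I

lemma continuous_crDeriv {G : ℂ → ℂ} (hG : ContDiff ℝ 1 G) : Continuous (crDeriv G) := by
  have := hG.continuous_fderiv one_ne_zero
  unfold crDeriv
  fun_prop

lemma crDeriv_mul {F G : ℂ → ℂ} {z : ℂ} (hF : DifferentiableAt ℝ F z)
    (hG : DifferentiableAt ℝ G z) :
    crDeriv (fun z => F z * G z) z = crDeriv F z * G z + F z * crDeriv G z := by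
  unfold crDeriv
  rw [fderiv_fun_mul hF hG]
  simp only [add_apply, smul_apply, smul_eq_mul]
  ring

lemma crDeriv_eq_zero_of_differentiableAt {G : ℂ → ℂ} {z : ℂ} (hG : DifferentiableAt ℂ G z) :
    crDeriv G z = 0 := by
  unfold crDeriv
  have h : fderiv ℝ G z = (fderiv ℂ G z).restrictScalars ℝ :=
    (hG.hasFDerivAt.restrictScalars ℝ).fderiv
  have h2 : fderiv ℂ G z Complex.I = Complex.I * fderiv ℂ G z 1 := by
    rw [← smul_eq_mul, ← map_smul, smul_eq_mul, mul_one]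
  rw [h]
  simp only [ContinuousLinearMap.coe_restrictScalars', h2]
  rw [← mul_assoc, Complex.I_mul_I]
  ring

lemma crDeriv_const (c z : ℂ) : crDeriv (fun _ => c) z = 0 :=
  crDeriv_eq_zero_of_differentiableAt (differentiableAt_const c)

lemma Filter.EventuallyEq.crDeriv_eq {F G : ℂ → ℂ} {z : ℂ} (h : F =ᶠ[𝓝 z] G) :
    crDeriv F z = crDeriv G z := by
  unfold crDeriv
  rw [h.fderiv_eq]

lemma tsupport_crDeriv_subset (G : ℂ → ℂ) : tsupport (crDeriv G) ⊆ tsupport G := by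
  refine closure_minimal (fun z hz => ?_) (isClosed_tsupport G)
  by_contra hn
  apply hz
  rw [(notMem_tsupport_iff_eventuallyEq.1 hn).crDeriv_eq]
  simp [crDeriv, Pi.zero_def]

/-- A continuous function of polar coordinates supported in a disc is integrable. -/
lemma integrableOn_polar_target {A : ℝ × ℝ → ℂ} (hA : Continuous A) {ρ : ℝ}
    (h0 : ∀ p : ℝ × ℝ, ρ < p.1 → A p = 0) :
    MeasureTheory.IntegrableOn A (Ioi (0 : ℝ) ×ˢ Ioo (-Real.pi) Real.pi) := by
  have h1 : MeasureTheory.IntegrableOn A (Icc (0 : ℝ) ρ ×ˢ Icc (-Real.pi) Real.pi) :=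
    hA.continuousOn.integrableOn_compact (isCompact_Icc.prod isCompact_Icc)
  refine h1.of_forall_sdiff_eq_zero (measurableSet_Ioi.prod measurableSet_Ioo) ?_
  rintro ⟨r, t⟩ ⟨⟨hr, ht⟩, hn⟩
  apply h0
  by_contra hle
  exact hn ⟨⟨le_of_lt hr, not_lt.1 hle⟩, ⟨ht.1.le, ht.2.le⟩⟩

/-- The rotation behaviour of the Cauchy–Riemann combination of a real-linear map. -/
lemma crCombination_rotate (L : ℂ →L[ℝ] ℂ) {e : ℂ} (he : ‖e‖ = 1) :
    L 1 + Complex.I * L Complex.I = e * (L e + Complex.I * L (Complex.I * e)) := by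
  have hlin : ∀ z : ℂ, L z = z.re * L 1 + z.im * L Complex.I := by
    intro z
    have : z = z.re • (1 : ℂ) + z.im • Complex.I := by simp
    conv_lhs => rw [this, map_add, map_smul, map_smul]
    simp
  have hcs : (e.re : ℂ) * e.re + e.im * e.im = 1 := by
    have := Complex.normSq_apply e
    rw [Complex.normSq_eq_norm_sq, he] at this
    exact_mod_cast (by linarith : e.re * e.re + e.im * e.im = 1)
  have hee : e = e.re + e.im * Complex.I := (Complex.re_add_im e).symm
  rw [hlin e, hlin (Complex.I * e)]
  simp only [Complex.I_mul_re, Complex.I_mul_im, Complex.ofReal_neg]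
  generalize L 1 = u at *
  generalize L Complex.I = v at *
  generalize (e.re : ℂ) = c at *
  generalize (e.im : ℂ) = s at *
  rw [hee]
  linear_combination (-(u + Complex.I * v)) * hcs + (s ^ 2 * u - c * s * v) * Complex.I_sq

/-- The Cauchy–Pompeiu formula at the origin for compactly supported functions. -/
lemma integral_crDeriv_div_self {G : ℂ → ℂ} (hG : ContDiff ℝ 1 G) (hs : HasCompactSupport G) :
    ∫ z, crDeriv G z / z = -(2 * Real.pi) * G 0 := by
  obtain ⟨ρ, hρ⟩ := hs.isCompact.isBounded.subset_closedBall 0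
  have hGd : ∀ z, HasFDerivAt G (fderiv ℝ G z) z := fun z =>
    (hG.differentiable one_ne_zero z).hasFDerivAt
  have hGc : Continuous (fderiv ℝ G) := hG.continuous_fderiv one_ne_zero
  have hout : ∀ z : ℂ, ρ < ‖z‖ → fderiv ℝ G z = 0 := by
    intro z hz
    by_contra hn
    have := hρ (support_fderiv_subset ℝ hn)
    simp at this
    linarith
  set e : ℝ → ℂ := fun t => Complex.exp (t * Complex.I) with he
  have hec : Continuous e := by fun_prop
  have hen : ∀ t, ‖e t‖ = 1 := fun t => Complex.norm_exp_ofReal_mul_I t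
  set A : ℝ × ℝ → ℂ := fun p => fderiv ℝ G (p.1 * e p.2) (e p.2) with hA
  set B : ℝ × ℝ → ℂ := fun p => fderiv ℝ G (p.1 * e p.2) (Complex.I * e p.2) with hB
  have hAc : Continuous A := by fun_prop
  have hBc : Continuous B := by fun_prop
  have hz : ∀ p : ℝ × ℝ, ρ < p.1 → fderiv ℝ G (p.1 * e p.2) = 0 := by
    intro p hp
    apply hout
    rw [norm_mul, hen, mul_one, Complex.norm_real, Real.norm_eq_abs]
    exact hp.trans_le (le_abs_self _)
  have hAi := integrableOn_polar_target hAc (ρ := ρ) fun p hp => by simp [hA, hz p hp]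
  have hBi := integrableOn_polar_target hBc (ρ := ρ) fun p hp => by simp [hB, hz p hp]
  have hsplit : ∫ z, crDeriv G z / z
      = ∫ p in Ioi (0 : ℝ) ×ˢ Ioo (-Real.pi) Real.pi, (A p + Complex.I * B p) := by
    rw [← Complex.integral_comp_polarCoord_symm]
    refine MeasureTheory.setIntegral_congr_fun (measurableSet_Ioi.prod measurableSet_Ioo) ?_
    rintro ⟨r, t⟩ ⟨hr, -⟩
    have hr' : (r : ℂ) ≠ 0 := by exact_mod_cast (ne_of_gt hr)
    have hpol : Complex.polarCoord.symm (r, t) = r * e t := by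
      rw [Complex.polarCoord_symm_apply, he]
      simp [Complex.exp_mul_I]
    have het0 : e t ≠ 0 := Complex.exp_ne_zero _
    simp only [hpol, hA, hB, crDeriv, crCombination_rotate _ (hen t), Complex.real_smul]
    field_simp
  have hAint : ∫ p in Ioi (0 : ℝ) ×ˢ Ioo (-Real.pi) Real.pi, A p = -(2 * Real.pi) * G 0 := by
    rw [MeasureTheory.Measure.volume_eq_prod, ← MeasureTheory.setIntegral_prod_swap,
      MeasureTheory.setIntegral_prod]
    · have hin : ∀ t : ℝ, ∫ r in Ioi (0 : ℝ), A (r, t) = -G 0 := by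
        intro t
        have hd : ∀ r : ℝ, HasDerivAt (fun r : ℝ => G (r * e t)) (A (r, t)) r := by
          intro r
          have h1 : HasDerivAt (fun r : ℝ => (r : ℂ) * e t) (e t) r := by
            simpa using (Complex.ofRealCLM.hasDerivAt (x := r)).mul_const (e t)
          exact (hGd _).comp_hasDerivAt r h1
        have := MeasureTheory.integral_Ioi_of_hasDerivAt_of_tendsto (a := 0) (m := 0)
          (hd 0).continuousAt.continuousWithinAt (fun r _ => hd r) ?_ ?_
        · rw [this]; simp
        · have h1 : MeasureTheory.IntegrableOn (fun r => A (r, t)) (Icc 0 ρ) :=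
            (by fun_prop : Continuous fun r => A (r, t)).integrableOn_Icc
          refine h1.of_forall_sdiff_eq_zero measurableSet_Ioi ?_
          rintro r ⟨hr, hn⟩
          have : ρ < r := by
            by_contra hle
            exact hn ⟨le_of_lt hr, not_lt.1 hle⟩
          simp [hA, hz (r, t) this]
        · refine tendsto_const_nhds.congr' ?_
          filter_upwards [eventually_gt_atTop ρ] with r hr
          symm
          by_contra hn
          have := hρ (subset_tsupport G hn)
          rw [mem_closedBall_zero_iff, norm_mul, hen, mul_one, Complex.norm_real,
            Real.norm_eq_abs] at this
          linarith [le_abs_self r]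
      simp only [Prod.swap_prod_mk, hin]
      rw [MeasureTheory.setIntegral_const]
      simp [MeasureTheory.Measure.real, Real.volume_Ioo]
      left
      rw [ENNReal.toReal_ofReal (by positivity)]
      push_cast
      ring
    · rw [← MeasureTheory.Measure.volume_eq_prod] at *
      exact hAi.swap
  have hBint : ∫ p in Ioi (0 : ℝ) ×ˢ Ioo (-Real.pi) Real.pi, B p = 0 := by
    rw [MeasureTheory.Measure.volume_eq_prod, MeasureTheory.setIntegral_prod]
    · refine MeasureTheory.setIntegral_eq_zero_of_forall_eq_zero fun r hr => ?_
      rw [← MeasureTheory.integral_Ioc_eq_integral_Ioo,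
        ← intervalIntegral.integral_of_le (by linarith [Real.pi_pos])]
      have hd : ∀ t : ℝ, HasDerivAt (fun t : ℝ => G (r * e t)) (r * B (r, t)) t := by
        intro t
        have h1 : HasDerivAt (fun t : ℝ => (r : ℂ) * e t) (r * (Complex.I * e t)) t := by
          have h0 : HasDerivAt (fun t : ℝ => (t : ℂ) * Complex.I) Complex.I t := by
            simpa using (Complex.ofRealCLM.hasDerivAt (x := t)).mul_const Complex.I
          have := (h0.cexp).const_mul (r : ℂ)
          simpa [he, mul_comm] using this
        have h2 := (hGd _).comp_hasDerivAt t h1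
        rwa [← Complex.real_smul (z := Complex.I * e t), map_smul, Complex.real_smul] at h2
      have hc : Continuous fun t => (r : ℂ) * B (r, t) := by fun_prop
      have := intervalIntegral.integral_eq_sub_of_hasDerivAt (a := -Real.pi) (b := Real.pi)
        (fun t _ => hd t) (hc.intervalIntegrable _ _)
      rw [intervalIntegral.integral_const_mul] at this
      have hr' : (r : ℂ) ≠ 0 := by exact_mod_cast (ne_of_gt hr)
      have hee : e Real.pi = e (-Real.pi) := by
        simp [he, Complex.exp_neg]
      rw [hee, sub_self] at this
      exact (mul_eq_zero.1 this).resolve_left hr'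
    · exact hBi
  rw [hsplit, MeasureTheory.integral_add hAi (hBi.const_mul _),
    MeasureTheory.integral_const_mul, hAint, hBint]
  ring

/-- The Cauchy–Pompeiu formula for compactly supported functions. -/
lemma integral_crDeriv_div_sub {G : ℂ → ℂ} (hG : ContDiff ℝ 1 G) (hs : HasCompactSupport G)
    (w : ℂ) : ∫ z, crDeriv G z / (z - w) = -(2 * Real.pi) * G w := by
  have h := integral_crDeriv_div_self (G := fun z => G (z + w))
    (hG.comp (contDiff_id.add contDiff_const)) (hs.comp_homeomorph (Homeomorph.addRight w))
  rw [zero_add] at h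
  rw [← h, ← MeasureTheory.integral_add_right_eq_self _ w]
  simp only [add_sub_cancel_right, crDeriv, fderiv_comp_add_right]

/-- The truncated radial Cauchy kernel is integrable on the plane. -/
lemma integrable_indicator_inv_norm (ρ : ℝ) :
    MeasureTheory.Integrable fun z : ℂ => (Iic ρ).indicator (fun t : ℝ => t⁻¹) ‖z‖ := by
  rw [MeasureTheory.integrable_fun_norm_addHaar (μ := MeasureTheory.volume)
    (f := (Iic ρ).indicator (fun t : ℝ => t⁻¹)), Complex.finrank_real_complex]
  have h1 : MeasureTheory.IntegrableOn (fun _ : ℝ => (1 : ℝ)) (Ioc 0 ρ) := by simp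
  have h2 := (MeasureTheory.integrable_indicator_iff measurableSet_Ioc).2 h1
  refine h2.integrableOn.congr_fun (fun y hy => ?_) measurableSet_Ioi
  have hy0 : (0 : ℝ) < y := hy
  by_cases hyρ : y ≤ ρ
  · simp [hyρ, hy0, hy0.ne']
  · simp [hyρ]

/-- Uniform bounds for Cauchy transforms of bounded densities on a disc. -/
lemma exists_cauchy_transform_bound (a : ℂ) (R R₀ : ℝ) : ∃ C : ℝ, 0 ≤ C ∧
    ∀ (ψ : ℂ → ℂ) (m : ℝ), Continuous ψ → 0 ≤ m → (∀ z, ‖ψ z‖ ≤ m) →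
      (∀ z, R < dist z a → ψ z = 0) → ∀ w, dist w a ≤ R₀ →
        MeasureTheory.Integrable (fun z => ψ z / (z - w)) ∧
          ‖∫ z, ψ z / (z - w)‖ ≤ m * C := by
  set k : ℂ → ℝ := fun z => (Iic (R + R₀)).indicator (fun t : ℝ => t⁻¹) ‖z‖ with hk
  have hk0 : ∀ z, 0 ≤ k z := fun z => by
    refine indicator_apply_nonneg fun _ => ?_
    positivity
  refine ⟨∫ z, k z, MeasureTheory.integral_nonneg hk0, fun ψ m hψ hm hb h0 w hw => ?_⟩
  have hki : MeasureTheory.Integrable fun z => m * k (z - w) :=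
    ((integrable_indicator_inv_norm (R + R₀)).comp_sub_right w).const_mul m
  have hle : ∀ z, ‖ψ z / (z - w)‖ ≤ m * k (z - w) := by
    intro z
    by_cases hz : R < dist z a
    · rw [h0 z hz]
      simpa using mul_nonneg hm (hk0 _)
    · have hzw : ‖z - w‖ ≤ R + R₀ := by
        rw [← dist_eq_norm]
        exact (dist_triangle_right z w a).trans (add_le_add (not_lt.1 hz) hw)
      have : k (z - w) = ‖z - w‖⁻¹ := indicator_of_mem (s := Iic (R + R₀)) hzw _
      rw [this, norm_div, div_eq_mul_inv]
      exact mul_le_mul_of_nonneg_right (hb z) (by positivity)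
  have hmeas : MeasureTheory.AEStronglyMeasurable (fun z => ψ z / (z - w)) :=
    (hψ.measurable.div (measurable_id.sub_const w)).aestronglyMeasurable
  refine ⟨hki.mono' hmeas (Eventually.of_forall hle), ?_⟩
  refine (MeasureTheory.norm_integral_le_of_norm_le hki (Eventually.of_forall hle)).trans ?_
  rw [MeasureTheory.integral_const_mul, MeasureTheory.integral_sub_right_eq_self k w]

/-- The Cauchy transform of a density supported off `X` lies in `R(X)`. -/
lemma exists_cauchy_transform_mem_RX {X : Set ℂ} (hX : IsCompact X) {ψ : ℂ → ℂ}
    (hψ : Continuous ψ) (hs : HasCompactSupport ψ) (hd : Disjoint (tsupport ψ) X) :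
    ∃ T ∈ RX X, ∀ w : X, T w = ∫ z, ψ z / (z - w) := by
  have : CompactSpace X := isCompact_iff_compactSpace.1 hX
  have hjoint : Continuous fun p : ℂ × X => ψ p.1 / (p.1 - p.2) := by
    rw [continuous_iff_continuousAt]
    rintro ⟨z, w⟩
    by_cases hz : z ∈ tsupport ψ
    · refine ContinuousAt.div (by fun_prop) (by fun_prop) ?_
      exact sub_ne_zero.2 fun h : z = w => disjoint_left.1 hd hz (h ▸ w.2)
    · have h1 : ∀ᶠ p : ℂ × X in 𝓝 (z, w), ψ p.1 = 0 :=
        continuousAt_fst.eventually (notMem_tsupport_iff_eventuallyEq.1 hz)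
      refine (continuousAt_const (y := (0 : ℂ))).congr ?_
      filter_upwards [h1] with p hp
      simp [hp]
  set K : C(ℂ, C(X, ℂ)) := ContinuousMap.curry ⟨_, hjoint⟩ with hK
  have hKval : ∀ z w, K z w = ψ z / (z - w) := fun z w => rfl
  have hKmem : ∀ z, K z ∈ RXAlgebra X := by
    intro z
    by_cases hz : z ∈ X
    · have : K z = 0 := by
        ext w
        rw [hKval, image_eq_zero_of_notMem_tsupport fun h => disjoint_left.1 hd h hz]
        simp
      rw [this]
      exact zero_mem _
    · have hne : ∀ w : X, z - w ≠ 0 := fun w h => hz (by rw [sub_eq_zero.1 h]; exact w.2)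
      let u : C(X, ℂ) := ⟨fun w => (z - w)⁻¹,
        (continuous_const.sub continuous_subtype_val).inv₀ hne⟩
      have hu : u ∈ RXAlgebra X := inv_sub_mem_RX hz fun _ => rfl
      have : K z = ψ z • u := by
        ext w
        rw [hKval, div_eq_mul_inv]
        rfl
      rw [this]
      exact Subalgebra.smul_mem _ hu _
  let F : ℂ → (RXAlgebra X).toSubmodule := fun z => ⟨K z, hKmem z⟩
  have hFc : Continuous F := K.continuous.subtype_mk _
  have hK0 : ∀ z, ψ z = 0 → K z = 0 := by
    intro z hz
    ext w
    rw [hKval, hz]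
    simp
  have hFs : HasCompactSupport F := by
    refine hs.mono fun z hz hz0 => hz ?_
    exact Subtype.ext (hK0 z hz0)
  have hFi : MeasureTheory.Integrable F := hFc.integrable_of_hasCompactSupport hFs
  have : CompleteSpace (RXAlgebra X).toSubmodule := inferInstanceAs (CompleteSpace (RXAlgebra X))
  refine ⟨(∫ z, F z : (RXAlgebra X).toSubmodule), (∫ z, F z).2, fun w => ?_⟩
  have h1 := ContinuousLinearMap.integral_comp_comm (RXAlgebra X).toSubmodule.subtypeL hFi
  have h2 : ((∫ z, F z : (RXAlgebra X).toSubmodule) : C(X, ℂ)) = ∫ z, K z := h1.symm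
  rw [h2, ContinuousMap.integral_apply]
  · rfl
  · exact K.continuous.integrable_of_hasCompactSupport
      (hs.mono fun z hz hz0 => hz (hK0 z hz0))

lemma contDiff_eval_complex (p : Polynomial ℂ) : ContDiff ℝ 1 fun z : ℂ => p.eval z :=
  p.differentiable.contDiff.restrict_scalars ℝ

/-- A smooth function agreeing with a rational function near `Y`, small on a closed set `A`
where the rational function is small on `A ∩ Y`. -/
lemma exists_smooth_extension {Y A : Set ℂ} (hY : IsClosed Y) (hA : IsClosed A)
    {p q : Polynomial ℂ} (hq : ∀ z ∈ Y, q.eval z ≠ 0) {η : ℝ} (hη : 0 < η)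
    (hsmall : ∀ z ∈ Y ∩ A, ‖p.eval z / q.eval z‖ < η) :
    ∃ r : ℂ → ℂ, ContDiff ℝ 1 r ∧ (∀ z ∈ Y, r =ᶠ[𝓝 z] fun z => p.eval z / q.eval z) ∧
      ∀ z ∈ A, ‖r z‖ ≤ η := by
  set N : Set ℂ := {z | q.eval z ≠ 0 ∧ (z ∈ A → ‖p.eval z / q.eval z‖ < η)} with hN
  have hYN : Y ⊆ interior N := by
    intro y hy
    rw [mem_interior_iff_mem_nhds]
    have h1 : ∀ᶠ z in 𝓝 y, q.eval z ≠ 0 := q.continuous.continuousAt.eventually_ne (hq y hy)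
    have h2 : ∀ᶠ z in 𝓝 y, z ∈ A → ‖p.eval z / q.eval z‖ < η := by
      by_cases hyA : y ∈ A
      · have hc : ContinuousAt (fun z => ‖p.eval z / q.eval z‖) y :=
          (p.continuous.continuousAt.div q.continuous.continuousAt (hq y hy)).norm
        filter_upwards [hc.eventually_lt continuousAt_const (hsmall y ⟨hy, hyA⟩)] with z hz _
        exact hz
      · filter_upwards [hA.isOpen_compl.mem_nhds hyA] with z hz hzA
        exact absurd hzA hz
    exact h1.and h2
  obtain ⟨χ, h0, h1, h01⟩ := exists_contMDiffMap_zero_one_nhds_of_isClosed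
    (n := 1) (modelWithCornersSelf ℝ ℂ)
    (isOpen_interior (s := N)).isClosed_compl hY (disjoint_compl_left_iff_subset.2 hYN)
  rw [eventually_nhdsSet_iff_forall] at h0 h1
  have hχ : ContDiff ℝ 1 χ := χ.contMDiff.contDiff
  refine ⟨fun z => χ z * (p.eval z / q.eval z), ?_, fun z hz => ?_, fun z hz => ?_⟩
  · rw [contDiff_iff_contDiffAt]
    intro z
    by_cases hz : z ∈ interior N
    · have hχ' : ContDiffAt ℝ 1 (fun z => (χ z : ℂ)) z :=
        (Complex.ofRealCLM.contDiff.comp hχ).contDiffAt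
      simp only [div_eq_mul_inv]
      exact hχ'.mul ((contDiff_eval_complex p).contDiffAt.mul
        ((contDiff_eval_complex q).contDiffAt.inv (interior_subset hz).1))
    · refine (contDiffAt_const (c := (0 : ℂ))).congr_of_eventuallyEq ?_
      filter_upwards [h0 z hz] with x hx
      simp [hx]
  · filter_upwards [h1 z hz] with x hx
    simp [hx]
  · by_cases hzN : z ∈ interior N
    · have := (interior_subset hzN).2 hz
      rw [norm_mul, Complex.norm_real, Real.norm_of_nonneg (h01 z).1]
      exact (mul_le_of_le_one_left (norm_nonneg _) (h01 z).2).trans this.le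
    · simp [(h0 z hzN).self_of_nhds, hη.le]

/-- Extension by zero: if `g ∈ R(Y)`, `Y` contains the part of `X` in a closed disc and `g`
vanishes on `Y` near the boundary of the disc, then the function equal to `g` in the disc and to
zero elsewhere lies in `R(X)`. -/
lemma exists_extend_by_zero_mem_RX {X Y : Set ℂ} (hX : IsCompact X) (hY : IsCompact Y) {a : ℂ}
    {R' R : ℝ} (hR' : 0 < R') (hR : R' < R) (hXY : X ∩ closedBall a R ⊆ Y) {g : C(Y, ℂ)}
    (hg : g ∈ RX Y) (hg0 : ∀ y : Y, R' ≤ dist (y : ℂ) a → dist (y : ℂ) a ≤ R → g y = 0) :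
    ∃ f ∈ RX X, (∀ (w : X) (hw : (w : ℂ) ∈ Y), dist (w : ℂ) a ≤ R → f w = g ⟨w, hw⟩) ∧
      ∀ w : X, R < dist (w : ℂ) a → f w = 0 := by
  have : CompactSpace X := isCompact_iff_compactSpace.1 hX
  have : CompactSpace Y := isCompact_iff_compactSpace.1 hY
  let φ : ContDiffBump a := ⟨R', R, hR', hR⟩
  have hφ1 : ∀ z, dist z a ≤ R' → φ z = 1 := fun z hz => φ.one_of_mem_closedBall hz
  have hφ0 : ∀ z, R ≤ dist z a → φ z = 0 := fun z hz => φ.zero_of_le_dist hz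
  set Φ : ℂ → ℂ := fun z => (φ z : ℂ) with hΦ
  have hΦc : ContDiff ℝ 1 Φ := Complex.ofRealCLM.contDiff.comp φ.contDiff
  have hΦs : HasCompactSupport Φ := φ.hasCompactSupport.comp_left (g := fun t : ℝ => (t : ℂ)) rfl
  have hΦn : ∀ z, ‖Φ z‖ ≤ 1 := fun z => by
    rw [hΦ, Complex.norm_real, Real.norm_of_nonneg φ.nonneg]
    exact φ.le_one
  obtain ⟨G', hG'⟩ := ContinuousMap.exists_restrict_eq hY.isClosed g
  have hG'v : ∀ (z : ℂ) (hz : z ∈ Y), G' z = g ⟨z, hz⟩ := fun z hz =>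
    congrArg (fun k : C(Y, ℂ) => k ⟨z, hz⟩) hG'
  let f : C(X, ℂ) := ⟨fun w => Φ w * G' w,
    (hΦc.continuous.comp continuous_subtype_val).mul (G'.continuous.comp continuous_subtype_val)⟩
  have hfv : ∀ w : X, f w = Φ w * G' w := fun w => rfl
  refine ⟨f, ?_, fun w hw hwR => ?_, fun w hw => ?_⟩
  · have hDs : HasCompactSupport (crDeriv Φ) :=
      IsCompact.of_isClosed_subset hΦs (isClosed_tsupport _) (tsupport_crDeriv_subset Φ)
    obtain ⟨M, hM⟩ := hDs.exists_bound_of_continuous (continuous_crDeriv hΦc)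
    have hM0 : 0 ≤ M := (norm_nonneg _).trans (hM 0)
    obtain ⟨R₀, hR₀⟩ := hX.isBounded.subset_closedBall a
    obtain ⟨C, hC0, hC⟩ := exists_cauchy_transform_bound a R R₀
    have hcl : IsClosed (RX X) := isClosed_closure
    rw [← hcl.closure_eq, Metric.mem_closure_iff]
    intro ε hε
    set η : ℝ := ε / (2 * (1 + M * C)) with hη
    have hMC : 0 ≤ M * C := mul_nonneg hM0 hC0
    have hη0 : 0 < η := by positivity
    obtain ⟨s, ⟨p, q, hq, hs⟩, hgs⟩ := Metric.mem_closure_iff.1 hg η hη0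
    have hgs' : ∀ y : Y, ‖g y - p.eval (y : ℂ) / q.eval (y : ℂ)‖ < η := fun y => by
      rw [← hs y, ← dist_eq_norm]
      exact (ContinuousMap.dist_apply_le_dist y).trans_lt hgs
    set A : Set ℂ := {z | R' ≤ dist z a ∧ dist z a ≤ R} with hA
    have hAc : IsClosed A :=
      (isClosed_le continuous_const (continuous_id.dist continuous_const)).inter
        (isClosed_le (continuous_id.dist continuous_const) continuous_const)
    obtain ⟨r, hrc, hrY, hrA⟩ := exists_smooth_extension hY.isClosed hAc hq hη0 (by
      rintro z ⟨hzY, hzA⟩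
      simpa [hg0 ⟨z, hzY⟩ hzA.1 hzA.2] using hgs' ⟨z, hzY⟩)
    have hGc : ContDiff ℝ 1 fun z => Φ z * r z := hΦc.mul hrc
    have hder : ∀ z, crDeriv (fun z => Φ z * r z) z
        = crDeriv Φ z * r z + Φ z * crDeriv r z := fun z =>
      crDeriv_mul (hΦc.differentiable one_ne_zero z) (hrc.differentiable one_ne_zero z)
    have hoff : ∀ z, R < dist z a → Φ =ᶠ[𝓝 z] fun _ => 0 := fun z hz => by
      filter_upwards [(isOpen_lt continuous_const (by fun_prop :
        Continuous fun x : ℂ => dist x a)).mem_nhds hz] with x hx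
      simp [hΦ, hφ0 x (le_of_lt hx)]
    have hin : ∀ z, dist z a < R' → Φ =ᶠ[𝓝 z] fun _ => 1 := fun z hz => by
      filter_upwards [(isOpen_lt (by fun_prop : Continuous fun x : ℂ => dist x a)
        continuous_const).mem_nhds hz] with x hx
      simp [hΦ, hφ1 x (le_of_lt hx)]
    have hψ₁c : Continuous fun z => crDeriv Φ z * r z :=
      (continuous_crDeriv hΦc).mul hrc.continuous
    have hψ₂c : Continuous fun z => Φ z * crDeriv r z :=
      hΦc.continuous.mul (continuous_crDeriv hrc)
    have hψ₂s : HasCompactSupport fun z => Φ z * crDeriv r z := hΦs.mul_right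
    have hψ₁off : ∀ z, R < dist z a → crDeriv Φ z * r z = 0 := fun z hz => by
      rw [(hoff z hz).crDeriv_eq, crDeriv_const, zero_mul]
    have hψ₂off : ∀ z, R < dist z a → Φ z * crDeriv r z = 0 := fun z hz => by
      simp [(hoff z hz).self_of_nhds]
    have hψ₁b : ∀ z, ‖crDeriv Φ z * r z‖ ≤ M * η := by
      intro z
      by_cases h1 : dist z a < R'
      · rw [(hin z h1).crDeriv_eq, crDeriv_const, zero_mul, norm_zero]
        positivity
      by_cases h2 : R < dist z a
      · rw [hψ₁off z h2, norm_zero]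
        positivity
      rw [norm_mul]
      exact mul_le_mul (hM z) (hrA z ⟨not_lt.1 h1, not_lt.1 h2⟩) (norm_nonneg _) hM0
    have hdisj : Disjoint (tsupport fun z => Φ z * crDeriv r z) X := by
      refine disjoint_right.2 fun w hw => notMem_tsupport_iff_eventuallyEq.2 ?_
      by_cases hwR : R < dist w a
      · filter_upwards [hoff w hwR] with z hz
        simp [hz]
      · have hwY : w ∈ Y := hXY ⟨hw, not_lt.1 hwR⟩
        filter_upwards [eventually_eventually_nhds.2 (hrY w hwY),
          q.continuous.continuousAt.eventually_ne (hq w hwY)] with z hz hqz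
        have hd : DifferentiableAt ℂ (fun x => p.eval x / q.eval x) z :=
          p.differentiableAt.fun_div q.differentiableAt hqz
        rw [EventuallyEq.crDeriv_eq hz, crDeriv_eq_zero_of_differentiableAt hd, mul_zero]
        rfl
    obtain ⟨T, hT, hTv⟩ := exists_cauchy_transform_mem_RX hX hψ₂c hψ₂s hdisj
    refine ⟨(-(2 * Real.pi : ℂ)⁻¹) • T, (RXAlgebra X).smul_mem hT _, ?_⟩
    have hpi : (1 : ℝ) ≤ 2 * Real.pi := by linarith [Real.pi_gt_three]
    have hpi0 : (2 * Real.pi : ℂ) ≠ 0 := by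
      exact_mod_cast (by positivity : (2 * Real.pi : ℝ) ≠ 0)
    have hbound : dist f ((-(2 * Real.pi : ℂ)⁻¹) • T) ≤ η + M * η * C := by
      rw [ContinuousMap.dist_le (by positivity)]
      intro w
      have hwR₀ : dist (w : ℂ) a ≤ R₀ := hR₀ w.2
      obtain ⟨hi₁, hb₁⟩ := hC _ (M * η) hψ₁c (by positivity) hψ₁b hψ₁off w hwR₀
      obtain ⟨m₂, hm₂⟩ := hψ₂s.exists_bound_of_continuous hψ₂c
      obtain ⟨hi₂, -⟩ := hC _ m₂ hψ₂c ((norm_nonneg _).trans (hm₂ 0)) hm₂ hψ₂off w hwR₀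
      have hCP := integral_crDeriv_div_sub hGc hΦs.mul_right (w : ℂ)
      simp only [hder, add_div] at hCP
      rw [MeasureTheory.integral_add hi₁ hi₂, ← hTv w] at hCP
      set I₁ := ∫ z, crDeriv Φ z * r z / (z - w) with hI₁
      have hval : f w - ((-(2 * Real.pi : ℂ)⁻¹) • T) w
          = Φ w * (G' w - r w) - (2 * Real.pi : ℂ)⁻¹ * I₁ := by
        have h1 : ((-(2 * Real.pi : ℂ)⁻¹) • T) w = -(2 * Real.pi : ℂ)⁻¹ * T w := rfl
        rw [h1, hfv]
        field_simp
        linear_combination hCP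
      rw [dist_eq_norm, hval]
      refine (norm_sub_le _ _).trans (add_le_add ?_ ?_)
      · by_cases hwR : R < dist (w : ℂ) a
        · simp [(hoff w hwR).self_of_nhds, hη0.le]
        · have hwY : (w : ℂ) ∈ Y := hXY ⟨w.2, not_lt.1 hwR⟩
          rw [norm_mul, (hrY w hwY).self_of_nhds, hG'v w hwY]
          exact (mul_le_of_le_one_left (norm_nonneg _) (hΦn w)).trans (hgs' ⟨w, hwY⟩).le
      · rw [norm_mul]
        refine (mul_le_of_le_one_left (norm_nonneg _) ?_).trans hb₁
        rw [norm_inv]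
        refine inv_le_one_of_one_le₀ ?_
        have : ‖(2 * Real.pi : ℂ)‖ = 2 * Real.pi := by
          rw [norm_mul, Complex.norm_real, Real.norm_of_nonneg Real.pi_pos.le]
          simp
        rwa [this]
    refine hbound.trans_lt ?_
    have : η + M * η * C = ε / 2 := by
      rw [hη]
      field_simp
    linarith
  · rw [hfv, hG'v w hw]
    by_cases h : dist (w : ℂ) a ≤ R'
    · simp [hΦ, hφ1 _ h]
    · rw [hg0 ⟨w, hw⟩ (le_of_not_ge h) hwR, mul_zero]
  · simp [hfv, hΦ, hφ0 _ hw.le]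

/-- If a neighbourhood of `c` in `X` lies in some `Y` with `R(Y)` regular, then every other point
of `X` can be separated from a neighbourhood of `c` by a function in `R(X)`. -/
lemma exists_vanishing_near_of_subset_regular {X Y : Set ℂ} (hX : IsCompact X)
    (hY : IsCompact Y) (hreg : RXRegular Y) {c : ℂ} {δ : ℝ} (hδ : 0 < δ)
    (hsub : X ∩ closedBall c δ ⊆ Y) (x : X) (hx : δ < dist (x : ℂ) c) :
    ∃ f ∈ RX X, f x = 1 ∧ ∀ w : X, dist (w : ℂ) c < δ / 3 → f w = 0 := by
  have : CompactSpace X := isCompact_iff_compactSpace.1 hX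
  have hL : IsClosed {z : ℂ | δ / 2 ≤ dist z c} := isClosed_le continuous_const (by fun_prop)
  have hd : Disjoint {z : ℂ | δ / 2 ≤ dist z c} (closedBall c (δ / 3)) := by
    refine disjoint_left.2 fun z (hz : δ / 2 ≤ dist z c) (hz' : dist z c ≤ δ / 3) => ?_
    linarith
  obtain ⟨u, hu, hu0, hu1⟩ := hreg.exists_zero_one hY hL isClosed_closedBall hd
  obtain ⟨f, hf, hf1, hf0⟩ := exists_extend_by_zero_mem_RX hX hY (half_pos hδ) (half_lt_self hδ)
    hsub hu fun y hy _ => hu0 y hy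
  refine ⟨1 - f, (RXAlgebra X).sub_mem (RXAlgebra X).one_mem hf, ?_, fun w hw => ?_⟩
  · rw [ContinuousMap.sub_apply, hf0 x hx]
    simp
  · have hwδ : dist (w : ℂ) c ≤ δ := by linarith
    have hwY : (w : ℂ) ∈ Y := hsub ⟨w.2, hwδ⟩
    rw [ContinuousMap.sub_apply, hf1 w hwY hwδ, hu1 ⟨w, hwY⟩ hw.le]
    simp

/-- If every point of a compact set `S` can be separated from `x` together with a neighbourhood,
then so can `S`. -/
lemma exists_vanishing_near_compact {X S : Set ℂ} [CompactSpace X] (hS : IsCompact S) (x : X)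
    (h : ∀ c ∈ S, ∃ f ∈ RX X, f x = 1 ∧ ∃ U ∈ 𝓝 c, ∀ w : X, (w : ℂ) ∈ U → f w = 0) :
    ∃ f ∈ RX X, f x = 1 ∧ ∃ U : Set ℂ, IsOpen U ∧ S ⊆ U ∧ ∀ w : X, (w : ℂ) ∈ U → f w = 0 := by
  refine hS.induction_on
    (p := fun S => ∃ f ∈ RX X, f x = 1 ∧
      ∃ U : Set ℂ, IsOpen U ∧ S ⊆ U ∧ ∀ w : X, (w : ℂ) ∈ U → f w = 0) ?_ ?_ ?_ ?_
  · exact ⟨1, (RXAlgebra X).one_mem, rfl, ∅, isOpen_empty, subset_rfl, fun _ h => h.elim⟩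
  · rintro s t hst ⟨f, hf, hfx, U, hU, htU, h0⟩
    exact ⟨f, hf, hfx, U, hU, hst.trans htU, h0⟩
  · rintro s t ⟨f, hf, hfx, U, hU, hsU, h0⟩ ⟨f', hf', hfx', U', hU', htU', h0'⟩
    refine ⟨f * f', (RXAlgebra X).mul_mem hf hf', by simp [hfx, hfx'], U ∪ U', hU.union hU',
      union_subset_union hsU htU', ?_⟩
    rintro w (hw | hw)
    · simp [h0 w hw]
    · simp [h0' w hw]
  · intro c hc
    obtain ⟨f, hf, hfx, U, hU, h0⟩ := h c hc
    exact ⟨interior U, mem_nhdsWithin_of_mem_nhds (interior_mem_nhds.2 hU), f, hf, hfx,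
      interior U, isOpen_interior, subset_rfl, fun w hw => h0 w (interior_subset hw)⟩

/-- There are arbitrarily small circles about `x` avoiding a given countable set. -/
lemma exists_sphere_disjoint_countable {E : Set ℂ} (hE : E.Countable) (x : ℂ) {ρ : ℝ}
    (hρ : 0 < ρ) : ∃ s, 0 < s ∧ s < ρ ∧ Disjoint (sphere x s) E := by
  have hc : ((fun z => dist z x) '' E).Countable := hE.image _
  obtain ⟨s, hs, hsn⟩ := (hc.dense_compl ℝ).exists_mem_open isOpen_Ioo (nonempty_Ioo.2 hρ)
  exact ⟨s, hsn.1, hsn.2, disjoint_left.2 fun z hz hzE => hs ⟨z, hzE, hz⟩⟩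

/-- Theorem 7.6: if a family of compact plane sets with `R(X_α)` regular
covers `X` up to a countable set via relative interiors, then `R(X)` is
regular. -/
theorem stmt19 (X : Set ℂ) (hXc : IsCompact X) (hXne : X.Nonempty)
    (E : Set ℂ) (hEX : E ⊆ X) (hEcnt : E.Countable)
    {ι : Type} (Y : ι → Set ℂ)
    (hYc : ∀ a, IsCompact (Y a)) (hYne : ∀ a, (Y a).Nonempty)
    (hYreg : ∀ a, RXRegular (Y a))
    (hcov : X \ E ⊆ ⋃ a, Subtype.val '' interior ((Subtype.val : X → ℂ) ⁻¹' Y a)) :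
    RXRegular X := by
  have : CompactSpace X := isCompact_iff_compactSpace.1 hXc
  intro F hF hFX x hx hxF
  obtain ⟨ρ, hρ, hρF⟩ := Metric.isOpen_iff.1 hF.isOpen_compl x hxF
  obtain ⟨s, hs0, hsρ, hsE⟩ := exists_sphere_disjoint_countable hEcnt x hρ
  obtain ⟨g, hg, hgx, U, hU, hSU, hgU⟩ := exists_vanishing_near_compact
    (hXc.inter_right (isClosed_sphere (x := x) (ε := s))) ⟨x, hx⟩ (by
      rintro c ⟨hcX, hcs⟩
      obtain ⟨α, hα⟩ := mem_iUnion.1 (hcov ⟨hcX, disjoint_left.1 hsE hcs⟩)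
      obtain ⟨c', hc', rfl⟩ := hα
      rw [mem_interior_iff_mem_nhds, mem_nhds_subtype_iff_nhdsWithin,
        Metric.mem_nhdsWithin_iff] at hc'
      obtain ⟨δ, hδ, hsub⟩ := hc'
      have hxc : dist x c' = s := by rw [dist_comm]; exact hcs
      set τ := min δ s / 2 with hτ
      have hm : 0 < min δ s := lt_min hδ hs0
      have hτδ : τ < δ := by linarith [min_le_left δ s]
      have hτs : τ < s := by linarith [min_le_right δ s]
      have hτ0 : 0 < τ := by linarith
      obtain ⟨f, hf, hfx, hf0⟩ := exists_vanishing_near_of_subset_regular hXc (hYc α) (hYreg α)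
        hτ0 (c := c') (fun z hz => by
          obtain ⟨w, hw, rfl⟩ := hsub ⟨closedBall_subset_ball hτδ hz.2, hz.1⟩
          exact hw) ⟨x, hx⟩ (by rw [hxc]; exact hτs)
      exact ⟨f, hf, hfx, ball (c' : ℂ) (τ / 3), ball_mem_nhds _ (by linarith), hf0⟩)
  have hxU : x ∉ U := fun h => one_ne_zero (hgx.symm.trans (hgU ⟨x, hx⟩ h))
  have hK : IsCompact ((X ∩ closedBall x s) \ U) :=
    (hXc.inter_right isClosed_closedBall).diff hU
  obtain ⟨m, hm, hmax⟩ := hK.exists_isMaxOn ⟨x, ⟨hx, mem_closedBall_self hs0.le⟩, hxU⟩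
    (f := fun z => dist z x) (by fun_prop)
  have hms : dist m x < s := lt_of_le_of_ne hm.1.2 fun h => hm.2 (hSU ⟨hm.1.1, h⟩)
  obtain ⟨R', hmR, hRs⟩ := exists_between hms
  obtain ⟨f, hf, hf1, hf0⟩ := exists_extend_by_zero_mem_RX hXc hXc
    (dist_nonneg.trans_lt hmR) hRs inter_subset_left hg (fun y hy hys => hgU y (by
      by_contra hyU
      have : dist (y : ℂ) x ≤ dist m x := hmax ⟨⟨y.2, hys⟩, hyU⟩
      linarith))
  refine ⟨f, hf, ?_, fun y hy hyF => hf0 ⟨y, hy⟩ ?_⟩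
  · rw [hf1 ⟨x, hx⟩ hx (by simpa using hs0.le), hgx]
  · by_contra hle
    exact hρF (mem_ball.2 ((not_lt.1 hle).trans_lt hsρ)) hyF

end
end
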